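/- Up to isomorphism there are exactly 39 combinatorial 3-manifolds on 8 vertices; that is, there exist 39 pairwise non-isomorphic combinatorial 3-manifolds with exactly 8 vertices such that every combinatorial 3-manifold with exactly 8 vertices is isomorphic to one of them. Moreover, every combinatorial 3-manifold on 8 vertices is bistellar equivalent to the standard 3-sphere S^3_5 (i.e., is a combinatorial 3-sphere). -/

import Mathlib

/-! Basic framework for finite simplicial complexes, pseudomanifolds and
bistellar moves, following Datta–Nilakantan. A complex is recorded as the
finite set of its faces (nonempty finite subsets of the vertex type). -/

namespace NPM

variable {α β : Type*} [DecidableEq α] [DecidableEq β]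

/-- A "complex" datum: a finite family of finite subsets of `α`. -/
abbrev Complex (α : Type*) := Finset (Finset α)

/-- `K` is a simplicial complex: a nonempty collection of nonempty sets,
closed under passing to nonempty subsets. -/
def IsComplex (K : Complex α) : Prop :=
  K.Nonempty ∧ (∀ σ ∈ K, σ.Nonempty) ∧ ∀ σ ∈ K, ∀ τ ⊆ σ, τ.Nonempty → τ ∈ K

/-- The vertex set of `K`. -/
def verts (K : Complex α) : Finset α := K.sup id

/-- `K` is pure of dimension `d`: every face is contained in a face with
`d+1` vertices. -/
def IsPure (K : Complex α) (d : ℕ) : Prop :=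
  ∀ σ ∈ K, ∃ τ ∈ K, σ ⊆ τ ∧ τ.card = d + 1

/-- The facets ("`d`-faces") of a pure `d`-dimensional complex. -/
def facets (K : Complex α) (d : ℕ) : Complex α := K.filter (fun σ => σ.card = d + 1)

/-- The link of a face `σ` in `K`. -/
def link (K : Complex α) (σ : Finset α) : Complex α :=
  K.filter (fun τ => Disjoint τ σ ∧ σ ∪ τ ∈ K)

/-- The degree of a face: the number of vertices of its link. -/
def degree (K : Complex α) (σ : Finset α) : ℕ := (verts (link K σ)).card

/-- A weak `d`-pseudomanifold: a pure `d`-dimensional complex in which every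
`(d-1)`-face (i.e. face with `d` vertices) lies in exactly two facets. -/
def WeakPM (K : Complex α) (d : ℕ) : Prop :=
  IsComplex K ∧ IsPure K d ∧
    ∀ σ ∈ K, σ.card = d → (K.filter fun τ => σ ⊆ τ ∧ τ.card = d + 1).card = 2

/-- Strong connectedness: any two facets are joined by a chain of facets in
which consecutive facets meet in a `(d-1)`-face. -/
def SConn (K : Complex α) (d : ℕ) : Prop :=
  ∀ σ ∈ facets K d, ∀ τ ∈ facets K d,
    Relation.ReflTransGen
      (fun a b => a ∈ facets K d ∧ b ∈ facets K d ∧ (a ∩ b).card = d) σ τ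

/-- A `d`-pseudomanifold: a strongly connected weak `d`-pseudomanifold. -/
def IsPM (K : Complex α) (d : ℕ) : Prop := WeakPM K d ∧ SConn K d

/-- Connectedness of a complex: the graph of vertices and edges is connected. -/
def Conn (K : Complex α) : Prop :=
  (verts K).Nonempty ∧ ∀ u ∈ verts K, ∀ v ∈ verts K,
    Relation.ReflTransGen (fun a b => a ≠ b ∧ ({a, b} : Finset α) ∈ K) u v

/-- A normal `d`-pseudomanifold: a connected weak `d`-pseudomanifold in which
the link of every face of dimension `≤ d - 2` is connected. -/
def NormalPM (K : Complex α) (d : ℕ) : Prop :=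
  WeakPM K d ∧ Conn K ∧ ∀ σ ∈ K, σ.card + 1 ≤ d → Conn (link K σ)

/-- `K` is neighbourly: every pair of vertices forms an edge. -/
def Neighbourly (K : Complex α) : Prop :=
  ∀ u ∈ verts K, ∀ v ∈ verts K, u ≠ v → ({u, v} : Finset α) ∈ K

/-- Isomorphism of complexes: a map injective on the vertex set carrying the
faces of `K` exactly onto the faces of `L`. -/
def Iso (K : Complex α) (L : Complex β) : Prop :=
  ∃ f : α → β, Set.InjOn f ↑(verts K) ∧ L = K.image (fun σ => σ.image f)

/-- The complex generated by a family of facets: all nonempty subsets. -/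
def genCx (F : Finset (Finset α)) : Complex α :=
  F.biUnion fun σ => σ.powerset.filter (fun τ => τ.Nonempty)

/-- The standard sphere on the vertex set `B`: all nonempty proper subsets
of `B`. -/
def stdSphere (B : Finset α) : Complex α :=
  B.powerset.filter fun τ => τ.Nonempty ∧ τ ≠ B

/-- In a weak `d`-pseudomanifold, a removable `(d-i)`-face `A`: its link is a
standard sphere `S^{i-1}_{i+1}(B)` with `B` not a face.  (For `d = 3`,
`i = 1` gives removable 2-faces and `i = 2` gives removable 1-faces.) -/
def RemovableFace (d i : ℕ) (K : Complex α) (A : Finset α) : Prop :=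
  A ∈ K ∧ A.card = d - i + 1 ∧
    ∃ B : Finset α, B.card = i + 1 ∧ B ∉ K ∧ link K A = stdSphere B

/-- The bistellar `i`-move (`0 < i ≤ d`) relation on weak `d`-pseudomanifolds:
`L` is obtained from `K` by removing a removable `(d-i)`-face `A` with
`link K A = stdSphere B` and inserting the facets `(B ∪ A) \ {v}`, `v ∈ A`. -/
def BMove (d i : ℕ) (K L : Complex α) : Prop :=
  ∃ A B : Finset α, A ∈ K ∧ A.card = d - i + 1 ∧ B.card = i + 1 ∧ B ∉ K ∧
    link K A = stdSphere B ∧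
    L = genCx ((facets K d).filter (fun σ => ¬ A ⊆ σ) ∪
          A.image fun v => (B ∪ A).erase v)

/-- The bistellar `0`-move: star a new vertex `w` in a facet `σ`. -/
def BMove0 (d : ℕ) (K L : Complex α) : Prop :=
  ∃ σ w, σ ∈ K ∧ σ.card = d + 1 ∧ w ∉ verts K ∧
    L = genCx (((facets K d).erase σ) ∪ σ.image fun v => insert w (σ.erase v))

/-- A single bistellar move of any type `0 ≤ i ≤ d`. -/
def BStep (d : ℕ) (K L : Complex α) : Prop :=
  BMove0 d K L ∨ ∃ i, 0 < i ∧ i ≤ d ∧ BMove d i K L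

/-- Bistellar equivalence: a finite sequence of bistellar moves. -/
def BEquiv (d : ℕ) : Complex α → Complex α → Prop :=
  Relation.ReflTransGen (BStep d)

/-- A proper bistellar move: a bistellar `i`-move with `0 < i < d`. -/
def PMove (d : ℕ) (K L : Complex α) : Prop := ∃ i, 0 < i ∧ i < d ∧ BMove d i K L

/-- Proper bistellar equivalence. -/
def PEquiv (d : ℕ) : Complex α → Complex α → Prop :=
  Relation.ReflTransGen (PMove d)

/-- The result of the bistellar move on the face `A` of the weak
`d`-pseudomanifold `K` (deterministic form: `B` is the vertex set of
`link K A`). -/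
def kappa (d : ℕ) (K : Complex α) (A : Finset α) : Complex α :=
  genCx ((facets K d).filter (fun σ => ¬ A ⊆ σ) ∪
    A.image fun v => (verts (link K A) ∪ A).erase v)

/-- A cycle: a (finite) 1-pseudomanifold. -/
def Cycle (K : Complex α) : Prop := IsPM K 1

/-- A combinatorial 2-manifold: a weak 2-pseudomanifold all whose vertex
links are cycles. -/
def Comb2Mfd (K : Complex α) : Prop :=
  WeakPM K 2 ∧ ∀ v, ({v} : Finset α) ∈ K → Cycle (link K {v})

/-- The Euler characteristic `f₀ - f₁ + f₂` of a 2-dimensional complex. -/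
def eulerChar (K : Complex α) : ℤ :=
  ((K.filter fun σ => σ.card = 1).card : ℤ) -
    ((K.filter fun σ => σ.card = 2).card : ℤ) +
    ((K.filter fun σ => σ.card = 3).card : ℤ)

/-- A combinatorial 2-sphere: a connected combinatorial 2-manifold with
Euler characteristic 2. -/
def Comb2Sphere (K : Complex α) : Prop := Comb2Mfd K ∧ Conn K ∧ eulerChar K = 2

/-- A combinatorial 3-manifold: a 3-pseudomanifold all whose vertex links are
combinatorial 2-spheres. -/
def Comb3Mfd (K : Complex α) : Prop :=
  IsPM K 3 ∧ ∀ v, ({v} : Finset α) ∈ K → Comb2Sphere (link K {v})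

end NPM

namespace NPM

section Facets

variable {α : Type*} [DecidableEq α]

/-- The number of vertices of the link of `σ` in the complex with facets `Φ`. -/
def facetDegree (Φ : Finset (Finset α)) (σ : Finset α) : ℕ :=
  ((Φ.filter (σ ⊆ ·)).sup id \ σ).card

/-- The facets of the link of `σ` in the complex with facets `Φ`. -/
def facetLink (Φ : Finset (Finset α)) (σ : Finset α) : Finset (Finset α) :=
  (Φ.filter (σ ⊆ ·)).image (· \ σ)

/-- Every `d`-element subset of a member of `Φ` lies in exactly two members of `Φ`. -/
def RidgesPaired (Φ : Finset (Finset α)) (d : ℕ) : Prop :=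
  ∀ τ : Finset α, τ.card = d → ∀ a ∈ Φ, τ ⊆ a → (Φ.filter (τ ⊆ ·)).card = 2

/-- The members of `Φ` containing `σ` are connected via intersections with `d` elements. -/
def StarConn (Φ : Finset (Finset α)) (d : ℕ) (σ : Finset α) : Prop :=
  ∀ (S : Set (Finset α)), ∀ a ∈ Φ, σ ⊆ a → a ∈ S →
    (∀ b ∈ Φ, ∀ c ∈ Φ, σ ⊆ b → σ ⊆ c → b ∈ S → (b ∩ c).card = d → c ∈ S) →
    ∀ c ∈ Φ, σ ⊆ c → c ∈ S

/-- The facet sets of combinatorial 3-manifolds. -/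
structure MfdFacets (Φ : Finset (Finset α)) : Prop where
  nonempty : Φ.Nonempty
  card : ∀ a ∈ Φ, a.card = 4
  ridge : RidgesPaired Φ 3
  star : ∀ σ : Finset α, σ.card ≤ 2 → StarConn Φ 3 σ
  euler : ∀ v ∈ Φ.sup id, (Φ.filter ({v} ⊆ ·)).card + 4 = 2 * facetDegree Φ {v}

variable {Φ : Finset (Finset α)} {σ τ : Finset α} {d : ℕ}

theorem mem_genCx : τ ∈ genCx Φ ↔ τ.Nonempty ∧ ∃ a ∈ Φ, τ ⊆ a := by
  simp only [genCx, Finset.mem_biUnion, Finset.mem_filter, Finset.mem_powerset]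
  tauto

theorem genCx_facets {K : Complex α} (hK : IsComplex K) (hp : IsPure K d) :
    genCx (facets K d) = K := by
  ext τ
  simp only [mem_genCx, facets, Finset.mem_filter]
  constructor
  · rintro ⟨h, a, ⟨ha, -⟩, h'⟩
    exact hK.2.2 a ha τ h' h
  · intro h
    obtain ⟨a, ha, h1, h2⟩ := hp τ h
    exact ⟨hK.2.1 τ h, a, ⟨ha, h2⟩, h1⟩

theorem facets_genCx (hc : ∀ a ∈ Φ, a.card = d + 1) : facets (genCx Φ) d = Φ := by
  ext τ
  simp only [mem_genCx, facets, Finset.mem_filter]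
  constructor
  · rintro ⟨⟨-, a, ha, h⟩, h'⟩
    rwa [Finset.eq_of_subset_of_card_le h (by rw [hc a ha, h'])]
  · intro h
    exact ⟨⟨Finset.card_pos.1 (by rw [hc τ h]; omega), τ, h, subset_rfl⟩, hc τ h⟩

theorem verts_genCx : verts (genCx Φ) = Φ.sup id := by
  ext v
  simp only [verts, Finset.mem_sup, mem_genCx, id]
  constructor
  · rintro ⟨τ, ⟨-, a, ha, h⟩, hv⟩
    exact ⟨a, ha, h hv⟩
  · rintro ⟨a, ha, hv⟩
    exact ⟨a, ⟨⟨v, hv⟩, a, ha, subset_rfl⟩, hv⟩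

theorem mem_facetLink : τ ∈ facetLink Φ σ ↔ Disjoint τ σ ∧ σ ∪ τ ∈ Φ := by
  simp only [facetLink, Finset.mem_image, Finset.mem_filter]
  constructor
  · rintro ⟨a, ⟨ha, h⟩, rfl⟩
    exact ⟨Finset.sdiff_disjoint, by rwa [Finset.union_sdiff_of_subset h]⟩
  · rintro ⟨h, h'⟩
    exact ⟨_, ⟨h', Finset.subset_union_left⟩, by
      rw [Finset.union_sdiff_left, Finset.sdiff_eq_self_of_disjoint h]⟩

theorem link_genCx : link (genCx Φ) σ = genCx (facetLink Φ σ) := by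
  ext τ
  simp only [link, Finset.mem_filter, mem_genCx, mem_facetLink]
  constructor
  · rintro ⟨⟨h, -⟩, hd, -, a, ha, h'⟩
    refine ⟨h, a \ σ, ⟨Finset.sdiff_disjoint, ?_⟩, ?_⟩
    · rwa [Finset.union_sdiff_of_subset (Finset.union_subset_left h')]
    · exact Finset.subset_sdiff.2 ⟨Finset.union_subset_right h', hd⟩
  · rintro ⟨h, a, ⟨hd, ha⟩, h'⟩
    exact ⟨⟨h, _, ha, h'.trans Finset.subset_union_right⟩, hd.mono_left h',
      h.mono Finset.subset_union_right, _, ha, Finset.union_subset_union_right h'⟩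

theorem card_facetLink (hc : ∀ a ∈ Φ, a.card = d + σ.card) :
    ∀ a ∈ facetLink Φ σ, a.card = d := by
  intro a ha
  obtain ⟨h, h'⟩ := mem_facetLink.1 ha
  have := hc _ h'
  rw [Finset.card_union_of_disjoint h.symm] at this
  omega

theorem filter_facetLink (h : Disjoint τ σ) :
    ((facetLink Φ σ).filter (τ ⊆ ·)).card = (Φ.filter (σ ∪ τ ⊆ ·)).card := by
  symm
  refine Finset.card_bij' (fun a _ => a \ σ) (fun a _ => σ ∪ a) ?_ ?_ ?_ ?_
  · intro a ha
    simp only [Finset.mem_filter, mem_facetLink] at ha ⊢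
    refine ⟨⟨Finset.sdiff_disjoint, ?_⟩, ?_⟩
    · rw [Finset.union_sdiff_of_subset (Finset.union_subset_left ha.2)]; exact ha.1
    · exact Finset.subset_sdiff.2 ⟨Finset.union_subset_right ha.2, h⟩
  · intro a ha
    simp only [Finset.mem_filter, mem_facetLink] at ha ⊢
    exact ⟨ha.1.2, Finset.union_subset_union_right ha.2⟩
  · intro a ha
    simp only [Finset.mem_filter] at ha
    exact Finset.union_sdiff_of_subset (Finset.union_subset_left ha.2)
  · intro a ha
    simp only [Finset.mem_filter, mem_facetLink] at ha
    simp only [Finset.union_sdiff_left, Finset.sdiff_eq_self_of_disjoint ha.1.1]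

theorem RidgesPaired.facetLink (h : RidgesPaired Φ (d + σ.card)) :
    RidgesPaired (facetLink Φ σ) d := by
  intro τ hτ a ha hs
  obtain ⟨hd, ha⟩ := mem_facetLink.1 ha
  have hd := hd.mono_left hs
  rw [filter_facetLink hd]
  refine h _ ?_ _ ha (Finset.union_subset_union_right hs)
  rw [Finset.card_union_of_disjoint hd.symm]
  omega

theorem starConn_facetLink_iff (h : Disjoint τ σ) :
    StarConn (facetLink Φ σ) d τ ↔ StarConn Φ (d + σ.card) (σ ∪ τ) := by
  have key : ∀ b c : Finset α, Disjoint b σ → Disjoint c σ →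
      ((σ ∪ b) ∩ (σ ∪ c)).card = (b ∩ c).card + σ.card := by
    intro b c hb hc
    rw [← Finset.union_inter_distrib_left, Finset.card_union_of_disjoint
      (hb.symm.mono_right Finset.inter_subset_left), add_comm]
  constructor
  · intro H S a ha hs haS hS c hc hcs
    have hl : ∀ b ∈ Φ, σ ∪ τ ⊆ b → b \ σ ∈ NPM.facetLink Φ σ ∧ τ ⊆ b \ σ ∧ σ ∪ b \ σ = b :=
      fun b hb hs => ⟨mem_facetLink.2 ⟨Finset.sdiff_disjoint, by
        rwa [Finset.union_sdiff_of_subset (Finset.union_subset_left hs)]⟩,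
        Finset.subset_sdiff.2 ⟨Finset.union_subset_right hs, h⟩,
        Finset.union_sdiff_of_subset (Finset.union_subset_left hs)⟩
    have := H {b | σ ∪ b ∈ S} (a \ σ) (hl a ha hs).1 (hl a ha hs).2.1
      (by simpa [(hl a ha hs).2.2] using haS) ?_ (c \ σ) (hl c hc hcs).1 (hl c hc hcs).2.1
    · simpa [(hl c hc hcs).2.2] using this
    · intro b hb c hc hbs hcs hbS hbc
      obtain ⟨hb1, hb2⟩ := mem_facetLink.1 hb
      obtain ⟨hc1, hc2⟩ := mem_facetLink.1 hc
      exact hS _ hb2 _ hc2 (Finset.union_subset_union_right hbs)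
        (Finset.union_subset_union_right hcs) hbS (by rw [key _ _ hb1 hc1, hbc])
  · intro H S a ha hs haS hS c hc hcs
    have hl : ∀ b ∈ NPM.facetLink Φ σ, (σ ∪ b) \ σ = b := fun b hb => by
      rw [Finset.union_sdiff_left, Finset.sdiff_eq_self_of_disjoint (mem_facetLink.1 hb).1]
    have := H {b | b \ σ ∈ S} (σ ∪ a) (mem_facetLink.1 ha).2 (Finset.union_subset_union_right hs)
      (by simpa [hl a ha] using haS) ?_ (σ ∪ c) (mem_facetLink.1 hc).2
      (Finset.union_subset_union_right hcs)
    · simpa [hl c hc] using this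
    · intro b hb c hc hbs hcs hbS hbc
      have hbu := Finset.union_sdiff_of_subset (Finset.union_subset_left hbs)
      have hcu := Finset.union_sdiff_of_subset (Finset.union_subset_left hcs)
      refine hS (b \ σ) ?_ (c \ σ) ?_ ?_ ?_ hbS ?_
      · exact mem_facetLink.2 ⟨Finset.sdiff_disjoint, by rwa [hbu]⟩
      · exact mem_facetLink.2 ⟨Finset.sdiff_disjoint, by rwa [hcu]⟩
      · exact Finset.subset_sdiff.2 ⟨Finset.union_subset_right hbs, h⟩
      · exact Finset.subset_sdiff.2 ⟨Finset.union_subset_right hcs, h⟩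
      · have := key (b \ σ) (c \ σ) Finset.sdiff_disjoint Finset.sdiff_disjoint
        rw [hbu, hcu, hbc] at this
        omega

theorem weakPM_genCx_iff (hc : ∀ a ∈ Φ, a.card = d + 1) (hd : 0 < d) :
    WeakPM (genCx Φ) d ↔ Φ.Nonempty ∧ RidgesPaired Φ d := by
  have key : ∀ τ : Finset α, ((genCx Φ).filter fun σ => τ ⊆ σ ∧ σ.card = d + 1) =
      Φ.filter (τ ⊆ ·) := by
    intro τ
    rw [← Finset.filter_filter, Finset.filter_comm]
    exact congrArg _ (facets_genCx hc)
  simp only [WeakPM, key]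
  constructor
  · rintro ⟨⟨⟨σ, hσ⟩, -⟩, -, h⟩
    refine ⟨?_, ?_⟩
    · obtain ⟨-, a, ha, -⟩ := mem_genCx.1 hσ
      exact ⟨a, ha⟩
    · intro τ hτ a ha hs
      exact h τ (mem_genCx.2 ⟨Finset.card_pos.1 (by omega), a, ha, hs⟩) hτ
  · rintro ⟨⟨a, ha⟩, h⟩
    have hne : ∀ a ∈ Φ, a.Nonempty := fun a ha => Finset.card_pos.1 (by rw [hc a ha]; omega)
    refine ⟨⟨⟨a, mem_genCx.2 ⟨hne a ha, a, ha, subset_rfl⟩⟩, ?_, ?_⟩, ?_, ?_⟩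
    · exact fun σ hσ => (mem_genCx.1 hσ).1
    · intro σ hσ τ hτ hn
      obtain ⟨-, b, hb, h'⟩ := mem_genCx.1 hσ
      exact mem_genCx.2 ⟨hn, b, hb, hτ.trans h'⟩
    · intro σ hσ
      obtain ⟨-, b, hb, h'⟩ := mem_genCx.1 hσ
      exact ⟨b, mem_genCx.2 ⟨hne b hb, b, hb, subset_rfl⟩, h', hc b hb⟩
    · intro σ hσ hcard
      obtain ⟨-, b, hb, h'⟩ := mem_genCx.1 hσ
      exact h σ hcard b hb h'

theorem sConn_genCx_iff (hc : ∀ a ∈ Φ, a.card = d + 1) :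
    SConn (genCx Φ) d ↔ StarConn Φ d ∅ := by
  rw [SConn, facets_genCx hc]
  constructor
  · intro H S a ha _ haS hS c hcΦ _
    induction H a ha c hcΦ with
    | refl => exact haS
    | tail _ h ih => exact hS _ h.1 _ h.2.1 (by simp) (by simp) (ih h.1 (by simp)) h.2.2
  · intro H a ha c hc
    refine H {b | Relation.ReflTransGen _ a b} a ha (by simp) .refl ?_ c hc (by simp)
    intro b hb c hc _ _ hbS hbc
    exact .tail hbS ⟨hb, hc, hbc⟩

theorem conn_genCx_iff (hd : 0 < d) (hs : ∀ v, StarConn Φ d {v})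
    (hc : ∀ a ∈ Φ, a.card = d + 1) :
    Conn (genCx Φ) ↔ Φ.Nonempty ∧ StarConn Φ d ∅ := by
  have hne : ∀ a ∈ Φ, a.Nonempty := fun a ha => Finset.card_pos.1 (by rw [hc a ha]; omega)
  simp only [Conn, verts_genCx]
  constructor
  · rintro ⟨⟨v, hv⟩, H⟩
    refine ⟨?_, ?_⟩
    · obtain ⟨a, ha, -⟩ := Finset.mem_sup.1 hv
      exact ⟨a, ha⟩
    intro S a ha _ haS hS c hcΦ _
    have hS' : ∀ u, ∀ b ∈ Φ, ∀ c ∈ Φ, u ∈ b → u ∈ c → b ∈ S → c ∈ S := by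
      intro u b hb c hc hub huc hbS
      refine hs u S b hb (by simpa) hbS ?_ c hc (by simpa)
      intro b hb c hc _ _
      exact hS b hb c hc (by simp) (by simp)
    obtain ⟨x, hx⟩ := hne a ha
    obtain ⟨y, hy⟩ := hne c hcΦ
    have hr := H x (Finset.mem_sup.2 ⟨a, ha, hx⟩) y (Finset.mem_sup.2 ⟨c, hcΦ, hy⟩)
    have : ∃ b ∈ Φ, y ∈ b ∧ b ∈ S := by
      clear hy
      induction hr with
      | refl => exact ⟨a, ha, hx, haS⟩
      | tail _ h ih =>
        obtain ⟨b, hb, h1, h2⟩ := ih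
        obtain ⟨-, e, he, hse⟩ := mem_genCx.1 h.2
        rw [Finset.insert_subset_iff, Finset.singleton_subset_iff] at hse
        exact ⟨e, he, hse.2, hS' _ b hb e he h1 hse.1 h2⟩
    obtain ⟨b, hb, h1, h2⟩ := this
    exact hS' y b hb c hcΦ h1 hy h2
  · rintro ⟨⟨a, ha⟩, H⟩
    have hstep : ∀ b ∈ Φ, ∀ x ∈ b, ∀ y ∈ b, Relation.ReflTransGen
        (fun a b => a ≠ b ∧ ({a, b} : Finset α) ∈ genCx Φ) x y := by
      intro b hb x hx y hy
      by_cases hxy : x = y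
      · rw [hxy]
      · refine .single ⟨hxy, mem_genCx.2 ⟨by simp, b, hb, ?_⟩⟩
        rw [Finset.insert_subset_iff, Finset.singleton_subset_iff]
        exact ⟨hx, hy⟩
    refine ⟨?_, ?_⟩
    · obtain ⟨x, hx⟩ := hne a ha
      exact ⟨x, Finset.mem_sup.2 ⟨a, ha, hx⟩⟩
    intro u hu v hv
    obtain ⟨b, hb, hub⟩ := Finset.mem_sup.1 hu
    obtain ⟨c, hcΦ, hvc⟩ := Finset.mem_sup.1 hv
    refine H {c | ∀ y ∈ c, Relation.ReflTransGen _ u y} b hb (by simp) (hstep b hb u hub)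
      ?_ c hcΦ (by simp) v hvc
    intro b _ c hc _ _ hbS hbc y hy
    obtain ⟨x, hx⟩ := Finset.card_pos.1 (hbc ▸ hd)
    rw [Finset.mem_inter] at hx
    exact (hbS x hx.1).trans (hstep c hc x hx.2 y hy)

theorem eulerChar_genCx (hc : ∀ a ∈ Φ, a.card = 3) (h : RidgesPaired Φ 2) :
    2 * eulerChar (genCx Φ) + Φ.card = 2 * (Φ.sup id).card := by
  have h2 : (genCx Φ).filter (fun σ => σ.card = 3) = Φ := facets_genCx (d := 2) hc
  have h0 : ((genCx Φ).filter (fun σ => σ.card = 1)).card = (Φ.sup id).card := by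
    symm
    refine Finset.card_bij (fun v _ => {v}) ?_ ?_ ?_
    · intro v hv
      obtain ⟨a, ha, hva⟩ := Finset.mem_sup.1 hv
      simp only [Finset.mem_filter, mem_genCx]
      exact ⟨⟨by simp, a, ha, by simpa using hva⟩, by simp⟩
    · simp
    · intro σ hσ
      simp only [Finset.mem_filter, mem_genCx] at hσ
      obtain ⟨⟨-, a, ha, hs⟩, h1⟩ := hσ
      obtain ⟨v, rfl⟩ := Finset.card_eq_one.1 h1
      exact ⟨v, Finset.mem_sup.2 ⟨a, ha, by simpa using hs⟩, rfl⟩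
  have h1 : ((genCx Φ).filter (fun σ => σ.card = 2)).card * 2 = Φ.card * 3 := by
    refine Finset.card_mul_eq_card_mul (fun σ a => σ ⊆ a) ?_ ?_
    · intro σ hσ
      simp only [Finset.mem_filter, mem_genCx] at hσ
      obtain ⟨⟨-, a, ha, hs⟩, h1⟩ := hσ
      exact h σ h1 a ha hs
    · intro a ha
      have : ((genCx Φ).filter (fun σ => σ.card = 2)).bipartiteBelow (fun σ a => σ ⊆ a) a =
          a.powersetCard 2 := by
        ext σ
        simp only [Finset.bipartiteBelow, Finset.mem_filter, mem_genCx, Finset.mem_powersetCard]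
        constructor
        · rintro ⟨⟨-, h⟩, h'⟩
          exact ⟨h', h⟩
        · rintro ⟨h, h'⟩
          exact ⟨⟨⟨Finset.card_pos.1 (by omega), a, ha, h⟩, h'⟩, h⟩
      rw [this, Finset.card_powersetCard, hc a ha]
      rfl
  unfold eulerChar
  rw [h2, h0]
  omega

theorem facetDegree_eq : facetDegree Φ σ = ((facetLink Φ σ).sup id).card := by
  unfold facetDegree
  congr 1
  ext x
  simp only [Finset.mem_sdiff, Finset.mem_sup, Finset.mem_filter, facetLink, Finset.mem_image, id]
  constructor
  · rintro ⟨⟨a, h, hx⟩, hx'⟩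
    exact ⟨a \ σ, ⟨a, h, rfl⟩, Finset.mem_sdiff.2 ⟨hx, hx'⟩⟩
  · rintro ⟨_, ⟨a, h, rfl⟩, hx⟩
    exact ⟨⟨a, h, (Finset.mem_sdiff.1 hx).1⟩, (Finset.mem_sdiff.1 hx).2⟩

theorem comb3Mfd_genCx_iff (hc : ∀ a ∈ Φ, a.card = 4) :
    Comb3Mfd (genCx Φ) ↔ MfdFacets Φ := by
  have hl1 : ∀ v, ∀ a ∈ facetLink Φ {v}, a.card = 3 := fun v => card_facetLink (by simpa using hc)
  have hl2 : ∀ v u, ∀ a ∈ facetLink (facetLink Φ {v}) {u}, a.card = 2 := fun v u =>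
    card_facetLink (by simpa using hl1 v)
  have hs2 : ∀ v u, u ≠ v → (StarConn (facetLink (facetLink Φ {v}) {u}) 1 ∅ ↔
      StarConn Φ 3 {v, u}) := by
    intro v u huv
    rw [starConn_facetLink_iff (by simp), starConn_facetLink_iff (by simpa using huv)]
    simp
  have hs1 : ∀ v u, u ≠ v → (StarConn (facetLink Φ {v}) 2 {u} ↔ StarConn Φ 3 {v, u}) := by
    intro v u huv
    rw [starConn_facetLink_iff (by simpa using huv)]
    simp
  have hs1' : ∀ v, StarConn (facetLink Φ {v}) 2 {v} := fun v S a ha hva => by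
    simpa using (Finset.disjoint_singleton_right.1 (mem_facetLink.1 ha).1 (by simpa using hva))
  have hs0 : ∀ v, (StarConn (facetLink Φ {v}) 2 ∅ ↔ StarConn Φ 3 {v}) := by
    intro v
    rw [starConn_facetLink_iff (by simp)]
    simp
  have hn : ∀ v, ({v} : Finset α) ∈ genCx Φ ↔ (facetLink Φ {v}).Nonempty := by
    intro v
    rw [mem_genCx, facetLink, Finset.image_nonempty, Finset.filter_nonempty_iff]
    simp
  have hn' : ∀ v, v ∈ Φ.sup id ↔ (facetLink Φ {v}).Nonempty := by
    intro v
    rw [← hn, mem_genCx, Finset.mem_sup]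
    simp
  have hcard : ∀ v, (facetLink Φ {v}).card = (Φ.filter ({v} ⊆ ·)).card := by
    intro v
    simpa using filter_facetLink (Φ := Φ) (σ := {v}) (τ := ∅) (by simp)
  simp only [Comb3Mfd, IsPM, weakPM_genCx_iff hc (by simp : 0 < 3), sConn_genCx_iff hc,
    Comb2Sphere, Comb2Mfd, Cycle, link_genCx,
    weakPM_genCx_iff (hl1 _) (by simp : 0 < 2), weakPM_genCx_iff (hl2 _ _) (by simp : 0 < 1),
    sConn_genCx_iff (hl2 _ _)]
  constructor
  · rintro ⟨⟨⟨hne, hr⟩, h0⟩, H⟩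
    have e2 : ∀ v u, u ≠ v → StarConn Φ 3 {v, u} := by
      intro v u huv S a ha hva haS
      rw [Finset.insert_subset_iff, Finset.singleton_subset_iff] at hva
      have hv : ({v} : Finset α) ∈ genCx Φ := mem_genCx.2 ⟨by simp, a, ha, by simpa using hva.1⟩
      refine (hs2 v u huv).1 ?_ S a ha ?_ haS
      · refine ((H v hv).1.2 u ?_).2
        rw [mem_genCx]
        refine ⟨by simp, a \ {v}, mem_facetLink.2 ⟨Finset.sdiff_disjoint, ?_⟩, ?_⟩
        · rwa [Finset.union_sdiff_of_subset (by simpa using hva.1)]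
        · simpa using ⟨hva.2, huv⟩
      · rw [Finset.insert_subset_iff, Finset.singleton_subset_iff]
        exact hva
    have e1' : ∀ v u, StarConn (facetLink Φ {v}) 2 {u} := by
      intro v u
      by_cases huv : u = v
      · rw [huv]; exact hs1' v
      · exact (hs1 v u huv).2 (e2 v u huv)
    refine ⟨hne, hc, hr, ?_, ?_⟩
    · intro σ hσ
      interval_cases h : σ.card
      · rwa [Finset.card_eq_zero.1 h]
      · obtain ⟨v, rfl⟩ := Finset.card_eq_one.1 h
        intro S a ha hva
        refine (hs0 v).1 ?_ S a ha hva
        exact ((conn_genCx_iff (by simp) (e1' v) (hl1 v)).1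
          (H v (mem_genCx.2 ⟨by simp, a, ha, hva⟩)).2.1).2
      · obtain ⟨v, u, hvu, rfl⟩ := Finset.card_eq_two.1 h
        exact e2 v u hvu.symm
    · intro v hv
      have := H v ((hn v).2 ((hn' v).1 hv))
      have he := eulerChar_genCx (hl1 v) this.1.1.2
      rw [this.2.2, ← facetDegree_eq, hcard] at he
      omega
  · intro G
    refine ⟨⟨⟨G.nonempty, G.ridge⟩, G.star ∅ (by simp)⟩, fun v hv => ?_⟩
    have e1' : ∀ u, StarConn (facetLink Φ {v}) 2 {u} := by
      intro u
      by_cases huv : u = v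
      · rw [huv]; exact hs1' v
      · exact (hs1 v u huv).2 (G.star _ Finset.card_le_two)
    have hr : RidgesPaired (facetLink Φ {v}) 2 := RidgesPaired.facetLink (by simpa using G.ridge)
    refine ⟨⟨⟨(hn v).1 hv, hr⟩, fun u hu => ⟨⟨?_, ?_⟩, ?_⟩⟩, ?_, ?_⟩
    · obtain ⟨-, a, ha, h⟩ := mem_genCx.1 hu
      exact ⟨_, Finset.mem_image_of_mem _ (Finset.mem_filter.2 ⟨ha, h⟩)⟩
    · exact RidgesPaired.facetLink (by simpa using hr)
    · obtain ⟨-, a, ha, h⟩ := mem_genCx.1 hu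
      have huv : u ≠ v := by
        rintro rfl
        exact Finset.disjoint_singleton_right.1 (mem_facetLink.1 ha).1 (by simpa using h)
      exact (hs2 v u huv).2 (G.star _ Finset.card_le_two)
    · exact (conn_genCx_iff (by simp) e1' (hl1 v)).2
        ⟨(hn v).1 hv, (hs0 v).2 (G.star _ (by simp))⟩
    · have he := eulerChar_genCx (hl1 v) hr
      have := G.euler v ((hn' v).2 ((hn v).1 hv))
      rw [← facetDegree_eq, hcard] at he
      omega

end Facets

section Transport

variable {α β : Type*} [DecidableEq β] {f : α → β}

theorem subset_sup_id [DecidableEq α] {Φ : Finset (Finset α)} {a : Finset α} (ha : a ∈ Φ) :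
    a ⊆ Φ.sup id :=
  Finset.le_sup (f := id) ha

theorem image_subset_image_iff_of_injOn {V a b : Finset α} (hf : Set.InjOn f ↑V) (ha : a ⊆ V)
    (hb : b ⊆ V) : a.image f ⊆ b.image f ↔ a ⊆ b := by
  refine ⟨fun h x hx => ?_, Finset.image_subset_image⟩
  obtain ⟨y, hy, hxy⟩ := Finset.mem_image.1 (h (Finset.mem_image_of_mem f hx))
  rwa [← hf (hb hy) (ha hx) hxy]

theorem image_injOn_of_injOn {V : Finset α} (hf : Set.InjOn f ↑V) :
    Set.InjOn (Finset.image f) {a | a ⊆ V} := by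
  intro a ha b hb h
  exact ((image_subset_image_iff_of_injOn hf ha hb).1 h.le).antisymm
    ((image_subset_image_iff_of_injOn hf hb ha).1 h.ge)

variable [DecidableEq α] {Φ : Finset (Finset α)}

theorem sup_image_image : (Φ.image (Finset.image f)).sup id = (Φ.sup id).image f := by
  ext x
  simp only [Finset.mem_sup, Finset.mem_image, id]
  constructor
  · rintro ⟨_, ⟨a, ha, rfl⟩, hx⟩
    obtain ⟨y, hy, rfl⟩ := Finset.mem_image.1 hx
    exact ⟨y, ⟨a, ha, hy⟩, rfl⟩
  · rintro ⟨y, ⟨a, ha, hy⟩, rfl⟩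
    exact ⟨_, ⟨a, ha, rfl⟩, Finset.mem_image_of_mem f hy⟩

theorem filter_image_image (hf : Set.InjOn f ↑(Φ.sup id)) {σ : Finset α}
    (hσ : σ ⊆ Φ.sup id) :
    (Φ.image (Finset.image f)).filter (σ.image f ⊆ ·) =
      (Φ.filter (σ ⊆ ·)).image (Finset.image f) := by
  rw [Finset.filter_image]
  congr 1
  refine Finset.filter_congr fun a ha => ?_
  exact image_subset_image_iff_of_injOn hf hσ (subset_sup_id ha)

theorem card_filter_image_image (hf : Set.InjOn f ↑(Φ.sup id)) {σ : Finset α}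
    (hσ : σ ⊆ Φ.sup id) :
    ((Φ.image (Finset.image f)).filter (σ.image f ⊆ ·)).card = (Φ.filter (σ ⊆ ·)).card := by
  rw [filter_image_image hf hσ]
  exact Finset.card_image_of_injOn ((image_injOn_of_injOn hf).mono fun a ha =>
    subset_sup_id (Finset.mem_filter.1 ha).1)

theorem facetDegree_image_image (hf : Set.InjOn f ↑(Φ.sup id)) {σ : Finset α}
    (hσ : σ ⊆ Φ.sup id) :
    facetDegree (Φ.image (Finset.image f)) (σ.image f) = facetDegree Φ σ := by
  have h : (Φ.filter (σ ⊆ ·)).sup id ⊆ Φ.sup id := Finset.sup_mono (Finset.filter_subset _ _)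
  have : ((Φ.filter (σ ⊆ ·)).sup id).image f \ σ.image f =
      ((Φ.filter (σ ⊆ ·)).sup id \ σ).image f := by
    ext x
    simp only [Finset.mem_sdiff, Finset.mem_image]
    constructor
    · rintro ⟨⟨y, hy, rfl⟩, hx⟩
      exact ⟨y, ⟨hy, fun h => hx ⟨y, h, rfl⟩⟩, rfl⟩
    · rintro ⟨y, ⟨hy, hy'⟩, rfl⟩
      refine ⟨⟨y, hy, rfl⟩, ?_⟩
      rintro ⟨z, hz, hzy⟩
      exact hy' (hf (hσ hz) (h hy) hzy ▸ hz)
  rw [facetDegree, filter_image_image hf hσ, sup_image_image, this, facetDegree]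
  exact Finset.card_image_of_injOn (hf.mono (Finset.sdiff_subset.trans h))

theorem MfdFacets.image_image (hΦ : MfdFacets Φ) (hf : Set.InjOn f ↑(Φ.sup id)) :
    MfdFacets (Φ.image (Finset.image f)) := by
  have hc : ∀ a ⊆ Φ.sup id, (a.image f).card = a.card := fun a ha =>
    Finset.card_image_of_injOn (hf.mono ha)
  refine ⟨hΦ.nonempty.image _, ?_, ?_, ?_, ?_⟩
  · simp only [Finset.mem_image]
    rintro _ ⟨a, ha, rfl⟩
    rw [hc a (subset_sup_id ha), hΦ.card a ha]
  · simp only [RidgesPaired, Finset.mem_image]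
    rintro τ hτ _ ⟨a, ha, rfl⟩ hs
    obtain ⟨σ, hσ, rfl⟩ := Finset.subset_image_iff.1 hs
    have hσV := hσ.trans (subset_sup_id ha)
    rw [card_filter_image_image hf hσV]
    rw [hc σ hσV] at hτ
    exact hΦ.ridge σ hτ a ha hσ
  · simp only [StarConn, Finset.mem_image]
    rintro τ hτ S _ ⟨a, ha, rfl⟩ hs haS hS _ ⟨c, hcΦ, rfl⟩ hcs
    obtain ⟨σ, hσ, rfl⟩ := Finset.subset_image_iff.1 hs
    have hσV := Set.Subset.trans hσ (subset_sup_id ha)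
    rw [hc σ hσV] at hτ
    refine hΦ.star σ hτ {b | b.image f ∈ S} a ha hσ haS ?_ c hcΦ
      ((image_subset_image_iff_of_injOn hf hσV (subset_sup_id hcΦ)).1 hcs)
    intro b hb c hcΦ hbσ hcσ hbS hbc
    refine hS _ ⟨b, hb, rfl⟩ _ ⟨c, hcΦ, rfl⟩ (Finset.image_subset_image hbσ)
      (Finset.image_subset_image hcσ) hbS ?_
    rw [← hbc, ← hc _ (Finset.inter_subset_left.trans (subset_sup_id hb)),
      Finset.image_inter_of_injOn]
    refine hf.mono (Set.union_subset ?_ ?_)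
    · exact subset_sup_id hb
    · exact subset_sup_id hcΦ
  · intro v hv
    rw [sup_image_image] at hv
    obtain ⟨v, hvV, rfl⟩ := Finset.mem_image.1 hv
    have hv' : {v} ⊆ Φ.sup id := Finset.singleton_subset_iff.2 hvV
    rw [← Finset.image_singleton, card_filter_image_image hf hv', facetDegree_image_image hf hv']
    exact hΦ.euler v hvV

theorem genCx_image_image :
    genCx (Φ.image (Finset.image f)) = (genCx Φ).image (fun σ => σ.image f) := by
  ext τ
  simp only [mem_genCx, Finset.mem_image]
  constructor
  · rintro ⟨h, _, ⟨a, ha, rfl⟩, hs⟩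
    obtain ⟨σ, hσ, rfl⟩ := Finset.subset_image_iff.1 hs
    exact ⟨σ, ⟨Finset.image_nonempty.1 h, a, ha, hσ⟩, rfl⟩
  · rintro ⟨σ, ⟨h, a, ha, hs⟩, rfl⟩
    exact ⟨h.image f, _, ⟨a, ha, rfl⟩, Finset.image_subset_image hs⟩

end Transport

section Normalised

variable {α : Type*} [DecidableEq α]

/-- A set of facets with vertices labelled `0, …, 7`, such that the vertex `7` and the
edge `{7, 6}` have maximal degree. -/
structure Normalised (Φ : Finset (Finset ℕ)) : Prop extends MfdFacets Φ where
  verts : Φ.sup id = Finset.range 8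
  vertex : ∀ i < 8, facetDegree Φ {i} ≤ facetDegree Φ {7}
  edge : ∀ i < 7, facetDegree Φ {7, i} ≤ facetDegree Φ {7, 6}

theorem exists_normalised {Φ : Finset (Finset α)} (hΦ : MfdFacets Φ) (h8 : (Φ.sup id).card = 8) :
    ∃ f : α → ℕ, Set.InjOn f ↑(Φ.sup id) ∧ Normalised (Φ.image (Finset.image f)) ∧
      {4, 5, 6, 7} ∈ Φ.image (Finset.image f) := by
  obtain ⟨v, hv, hvm⟩ := (Φ.sup id).exists_max_image (fun v => facetDegree Φ {v})
    (Finset.card_pos.1 (by omega))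
  obtain ⟨u, hu, hum⟩ := ((Φ.sup id).erase v).exists_max_image (fun u => facetDegree Φ {v, u})
    (Finset.card_pos.1 (by rw [Finset.card_erase_of_mem hv]; omega))
  have ⟨huv, huV⟩ := Finset.mem_erase.1 hu
  have hvu : ∃ e ∈ Φ, {v, u} ⊆ e := by
    obtain ⟨e, he, hve⟩ := Finset.mem_sup.1 hv
    rw [id] at hve
    have he4 := hΦ.card e he
    obtain ⟨x, hx⟩ := Finset.card_pos.1
      (show 0 < (e.erase v).card by rw [Finset.card_erase_of_mem hve]; omega)
    have ⟨hxv, hxe⟩ := Finset.mem_erase.1 hx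
    have hvx : {v, x} ⊆ e := by
      rw [Finset.insert_subset_iff, Finset.singleton_subset_iff]; exact ⟨hve, hxe⟩
    have h1 : 0 < facetDegree Φ {v, x} := by
      have h2 : e \ {v, x} ⊆ (Φ.filter ({v, x} ⊆ ·)).sup id \ {v, x} :=
        Finset.sdiff_subset_sdiff
          (Finset.le_sup (f := id) (Finset.mem_filter.2 ⟨he, hvx⟩)) le_rfl
      refine lt_of_lt_of_le ?_ (Finset.card_le_card h2)
      rw [Finset.card_sdiff_of_subset hvx, he4]
      have := Finset.card_le_two (a := v) (b := x)
      omega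
    have h2 := h1.trans_le (hum x (Finset.mem_erase.2 ⟨hxv, subset_sup_id he hxe⟩))
    by_contra! hcon
    rw [facetDegree, Finset.filter_false_of_mem hcon] at h2
    simp at h2
  obtain ⟨e, he, hvue⟩ := hvu
  have he2 : (e \ {v, u}).card = 2 := by
    rw [Finset.card_sdiff_of_subset hvue, hΦ.card e he, Finset.card_pair huv.symm]
  obtain ⟨a, b, hab, hee⟩ := Finset.card_eq_two.1 he2
  have hee' : e = {b, a, u, v} := by
    rw [← Finset.union_sdiff_of_subset hvue, hee]
    ext x; simp only [Finset.mem_union, Finset.mem_insert, Finset.mem_singleton]; tauto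
  have ha : a ∈ e \ {v, u} := by simp [hee]
  have hb : b ∈ e \ {v, u} := by simp [hee]
  simp only [Finset.mem_sdiff, Finset.mem_insert, Finset.mem_singleton, not_or] at ha hb
  have heV := subset_sup_id he
  obtain ⟨r, hr⟩ : ∃ r : List α, r.length = 4 ∧ r.Nodup ∧ ∀ x, x ∈ r ↔ x ∈ Φ.sup id \ e := by
    refine ⟨(Φ.sup id \ e).toList, ?_, Finset.nodup_toList _, fun x => Finset.mem_toList⟩
    rw [Finset.length_toList, Finset.card_sdiff_of_subset heV, h8, hΦ.card e he]
  obtain ⟨hr4, hrn, hrm⟩ := hr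
  set l := r ++ [b, a, u, v] with hl
  have hlm : ∀ x, x ∈ l ↔ x ∈ Φ.sup id := by
    intro x
    rw [hl, List.mem_append, hrm, ← Finset.union_sdiff_of_subset heV, Finset.mem_union, or_comm]
    apply or_congr
    · simp [hee']
    · rw [Finset.union_sdiff_of_subset heV]
  have hlast : ∀ x ∈ e, x ∉ r := fun x hx hxr => (Finset.mem_sdiff.1 ((hrm x).1 hxr)).2 hx
  have hidx : ∀ x ∈ e, l.idxOf x = [b, a, u, v].idxOf x + 4 := by
    intro x hx
    rw [hl, List.idxOf_append_of_notMem (hlast x hx), hr4, add_comm]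
  have hve : v ∈ e := hvue (by simp)
  have hue : u ∈ e := hvue (by simp)
  have fb : l.idxOf b = 4 := by rw [hidx b hb.1]; simp
  have fa : l.idxOf a = 5 := by rw [hidx a ha.1]; simp [hab.symm]
  have fu : l.idxOf u = 6 := by
    rw [hidx u hue]; simp [hb.2.2, ha.2.2]
  have fv : l.idxOf v = 7 := by
    rw [hidx v hve]; simp [hb.2.1, ha.2.1, huv]
  have hinj : Set.InjOn l.idxOf ↑(Φ.sup id) := by
    intro x hx y hy hxy
    exact (List.idxOf_inj ((hlm x).2 hx)).1 hxy
  have himg : (Φ.sup id).image l.idxOf = Finset.range 8 := by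
    refine Finset.eq_of_subset_of_card_le ?_ ?_
    · intro i hi
      obtain ⟨x, hx, rfl⟩ := Finset.mem_image.1 hi
      have := List.idxOf_lt_length_of_mem ((hlm x).2 hx)
      rw [Finset.mem_range]
      simpa [hl, hr4] using this
    · rw [Finset.card_image_of_injOn hinj, h8, Finset.card_range]
  have hpre : ∀ i < 8, ∃ x ∈ Φ.sup id, l.idxOf x = i := by
    intro i hi
    rw [← Finset.mem_range, ← himg] at hi
    simpa only [Finset.mem_image] using hi
  have dv : ∀ x ∈ Φ.sup id, facetDegree (Φ.image (Finset.image l.idxOf)) {l.idxOf x} =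
      facetDegree Φ {x} := by
    intro x hx
    rw [← facetDegree_image_image hinj (by simpa using hx), Finset.image_singleton]
  have de : ∀ x ∈ Φ.sup id, facetDegree (Φ.image (Finset.image l.idxOf)) {7, l.idxOf x} =
      facetDegree Φ {v, x} := by
    intro x hx
    rw [← facetDegree_image_image hinj (by
      rw [Finset.insert_subset_iff, Finset.singleton_subset_iff]; exact ⟨hv, hx⟩),
      Finset.image_insert, Finset.image_singleton, fv]
  refine ⟨l.idxOf, hinj, ⟨hΦ.image_image hinj, ?_, ?_, ?_⟩, ?_⟩
  · rw [sup_image_image, himg]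
  · intro i hi
    obtain ⟨x, hx, rfl⟩ := hpre i hi
    rw [← fv, dv x hx, dv v hv]
    exact hvm x hx
  · intro i hi
    obtain ⟨x, hx, rfl⟩ := hpre i (by omega)
    rw [← fu, de x hx, de u huV]
    refine hum x (Finset.mem_erase.2 ⟨?_, hx⟩)
    rintro rfl
    omega
  · refine Finset.mem_image.2 ⟨e, he, ?_⟩
    rw [hee']
    simp only [Finset.image_insert, Finset.image_singleton, fa, fb, fu, fv]

end Normalised

/-- `List.foldr` as a bare recursor, which the kernel evaluates faster. -/
def fold {β : Type} (g : ℕ → β → β) (z : β) (l : List ℕ) : β :=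
  List.rec z (fun a _ b => g a b) l

/-- Evaluate a natural number before passing it on. -/
def force {β : Type} (n : ℕ) (k : ℕ → β) : β := Nat.rec (k 0) (fun m _ => k m.succ) n

/-- `Nat.testBit` in terms of operations that the kernel evaluates quickly. -/
def tb (m i : ℕ) : Bool :=
  Nat.beq (Nat.land (Nat.shiftRight m i) (nat_lit 1)) (nat_lit 1)

/-- The labels used for vertices, largest first. -/
def labels : List ℕ :=
  [nat_lit 7, nat_lit 6, nat_lit 5, nat_lit 4, nat_lit 3, nat_lit 2, nat_lit 1, nat_lit 0]

/-- Inclusion of bit masks. -/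
def sub (m n : ℕ) : Bool := Nat.beq (Nat.land m n) m

/-- The set of values `g i` for the labels `i` in `m`, as a bit mask. -/
def maskOf (g : ℕ → ℕ) (m : ℕ) : ℕ :=
  fold (fun i a => bif tb m i then Nat.lor a (Nat.shiftLeft (nat_lit 1) (g i)) else a)
    (nat_lit 0) labels

/-- The mask `f` with the label `i` switched. -/
def flip (f i : ℕ) : ℕ := Nat.xor f (Nat.shiftLeft (nat_lit 1) i)

/-- The masks obtained from `f` by deleting one label, as a 256-bit mask. -/
def ridges (f : ℕ) : ℕ := maskOf (flip f) f

/-- The number of labels in a mask. -/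
def pop (m : ℕ) : ℕ := fold (fun i a => bif tb m i then Nat.succ a else a) (nat_lit 0) labels

/-- The union of those members of `F` that contain `s`. -/
def span (F : List ℕ) (s : ℕ) : ℕ :=
  fold (fun f a => bif sub s f then Nat.lor f a else a) (nat_lit 0) F

/-- The number of members of `F` that contain `s`. -/
def count (F : List ℕ) (s : ℕ) : ℕ :=
  fold (fun f a => bif sub s f then Nat.succ a else a) (nat_lit 0) F

/-- The number of vertices of the link of `s` in the complex with facets `F`. -/
def deg (F : List ℕ) (s : ℕ) : ℕ :=
  force (span F s) fun u => force (Nat.land u (Nat.xor u s)) pop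

/-- A list of masks as a 256-bit mask. -/
def key (F : List ℕ) : ℕ :=
  fold (fun m a => Nat.lor a (Nat.shiftLeft (nat_lit 1) m)) (nat_lit 0) F

/-- The 256-bit mask of all masks containing the `i`-th label. -/
def stars : List ℕ :=
  [nat_lit 77194726158210796949047323339125271902179989777093709359638389338608753093290, nat_lit
   92633671389852956338856788006950326282615987732512451231566067206330503711948, nat_lit
   108980789870415242751596221184647442685430573802955824978313020242741769072880, nat_lit
   115341536360906404779899502576747487978354537254490211650198994186870666100480, nat_lit
   115790322417210952336529717160220497262186272106556906860092653394915770695680, nat_lit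
   115792089210356248762697446947946071893095522863849111501270640965525260206080, nat_lit
   115792089237316195417293883273301227089774477609353836086800156426807153786880, nat_lit
   115792089237316195423570985008687907852929702298719625575994209400481361428480]

/-- The 256-bit mask of all masks containing the last label. -/
def lastStar : ℕ :=
  nat_lit 115792089237316195423570985008687907852929702298719625575994209400481361428480

/-- The 256-bit mask of all masks containing the last two labels. -/
def lastEdgeStar : ℕ :=
  nat_lit 115792089237316195417293883273301227089434195242432897623355228563449095127040

/-- The vertex `i` of `f` has a star without ridges in `o`, with wrong Euler characteristic. -/
def badVertex (f : ℕ) (F : List ℕ) (o i : ℕ) : Bool :=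
  bif tb f i then
    bif Nat.beq (Nat.land o (stars.getD i (nat_lit 0))) (nat_lit 0) then
      force (Nat.shiftLeft (nat_lit 1) i) fun s =>
      !Nat.beq (Nat.add (count F s) (nat_lit 4)) (Nat.mul (nat_lit 2) (deg F s))
    else false
  else false

/-- Some face `s ||| 2 ^ i` with `i` in `m` has larger degree than `r`. -/
def exceeds (F : List ℕ) (m s r : ℕ) : Bool :=
  force (deg F r) fun d =>
  bif Nat.beq d (nat_lit 7) then false else
  fold (fun i b => bif tb m i then
    bif force (Nat.lor s (Nat.shiftLeft (nat_lit 1) i)) fun s' => Nat.ble (deg F s') d then b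
    else true
    else b) false labels

/-- The facet list `F` with first member `f` has a closed star of wrong Euler characteristic,
or contradicts maximality of the degree of the vertex `7` or of the edge `{7, 6}`. -/
def bad (f : ℕ) (F : List ℕ) (o : ℕ) : Bool :=
  fold (fun i b => bif badVertex f F o i then true else b)
    (bif Nat.beq (Nat.land o lastStar) (nat_lit 0) then
      exceeds F (bif tb f (nat_lit 7) then (nat_lit 127) else f) (nat_lit 0) (nat_lit 128)
    else bif Nat.beq (Nat.land o lastEdgeStar) (nat_lit 0) then
      exceeds F (nat_lit 63) (nat_lit 128) (nat_lit 192)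
    else false) labels

/-- The image of the mask `m` under the relabelling with octal digits `c`. -/
def relabel (c m : ℕ) : ℕ :=
  maskOf (fun i => Nat.land (Nat.shiftRight c (Nat.mul (nat_lit 3) i)) (nat_lit 7)) m

/-- The facet lists of the 39 spheres with eight vertices. -/
def spheres : List (List ℕ) :=
  [[15, 23, 30, 45, 53, 57, 75, 83, 89, 90, 156, 172, 180, 184], [15, 23, 27, 30, 57, 77, 85, 105,
   113, 120, 156, 204, 212, 216], [15, 23, 30, 57, 75, 83, 89, 90, 141, 149, 156, 169, 177, 184],
   [15, 23, 30, 75, 83, 90, 105, 113, 120, 141, 149, 156, 169, 177, 184], [15, 23, 30, 75, 83, 90,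
   120, 141, 149, 156, 184, 201, 209, 232, 240], [15, 23, 30, 53, 90, 139, 141, 147, 156, 165,
   177, 180, 202, 210, 216], [15, 27, 30, 89, 113, 135, 141, 147, 150, 156, 177, 201, 216, 225,
   240], [15, 23, 30, 51, 85, 139, 141, 154, 156, 163, 177, 178, 197, 209, 212], [29, 30, 45, 46,
   85, 86, 101, 102, 153, 154, 169, 170, 209, 210, 225, 226], [15, 30, 39, 54, 75, 89, 90, 99,
   113, 114, 141, 153, 156, 165, 177, 180], [15, 23, 30, 75, 83, 90, 113, 120, 141, 149, 156, 177,
   184, 201, 225, 232], [15, 30, 43, 51, 58, 120, 135, 141, 147, 150, 156, 169, 177, 216, 232,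
   240], [15, 23, 30, 53, 75, 90, 141, 147, 156, 165, 177, 180, 195, 201, 210, 216], [15, 27, 30,
   89, 105, 113, 135, 141, 147, 150, 156, 169, 177, 216, 232, 240], [15, 27, 30, 57, 105, 120,
   135, 141, 147, 150, 156, 177, 201, 216, 225, 240], [15, 30, 39, 53, 54, 85, 139, 141, 154, 156,
   163, 177, 178, 197, 209, 212], [15, 30, 39, 54, 75, 89, 90, 99, 114, 141, 153, 156, 165, 180,
   209, 225, 240], [15, 23, 29, 43, 46, 89, 105, 147, 150, 156, 163, 166, 172, 209, 216, 225,
   232], [15, 30, 39, 54, 101, 113, 116, 139, 141, 154, 156, 163, 177, 178, 197, 209, 212], [15,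
   23, 45, 53, 60, 105, 120, 139, 142, 147, 150, 156, 177, 201, 216, 225, 240], [15, 30, 43, 51,
   58, 105, 120, 135, 141, 147, 150, 156, 177, 201, 216, 225, 240], [15, 30, 39, 51, 54, 75, 90,
   141, 147, 156, 165, 177, 180, 195, 201, 210, 216], [15, 27, 30, 39, 45, 51, 89, 150, 156, 166,
   169, 172, 177, 178, 201, 209, 216], [15, 39, 46, 53, 58, 60, 85, 139, 141, 154, 156, 163, 177,
   178, 197, 209, 212], [15, 39, 51, 78, 92, 102, 114, 116, 139, 141, 147, 156, 165, 177, 180,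
   202, 210, 216], [15, 39, 51, 54, 77, 92, 101, 116, 139, 142, 147, 150, 156, 177, 201, 216, 225,
   240], [15, 23, 43, 77, 85, 92, 105, 113, 142, 147, 150, 156, 163, 170, 177, 216, 232, 240],
   [15, 39, 46, 51, 58, 60, 77, 92, 139, 147, 154, 165, 177, 180, 197, 201, 212, 216], [23, 30,
   39, 43, 46, 53, 75, 90, 147, 156, 169, 172, 177, 180, 195, 201, 210, 216], [15, 43, 46, 51, 54,
   60, 105, 120, 135, 141, 147, 150, 156, 177, 201, 216, 225, 240], [15, 30, 39, 45, 75, 90, 99,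
   113, 114, 150, 156, 166, 169, 172, 177, 178, 201, 209, 216], [15, 23, 45, 46, 54, 101, 105,
   116, 120, 139, 147, 149, 170, 178, 184, 197, 201, 212, 216], [15, 46, 51, 54, 60, 75, 99, 106,
   120, 135, 141, 147, 150, 156, 177, 201, 216, 225, 240], [15, 27, 30, 39, 51, 77, 89, 101, 108,
   150, 156, 166, 172, 177, 178, 209, 216, 225, 232], [15, 23, 30, 43, 45, 83, 99, 106, 113, 149,
   154, 156, 165, 172, 177, 202, 210, 232, 240], [39, 45, 51, 71, 83, 90, 92, 102, 106, 108, 141,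
   154, 156, 169, 170, 177, 178, 197, 209, 212], [15, 27, 30, 51, 71, 77, 89, 99, 102, 108, 150,
   156, 166, 172, 177, 178, 209, 216, 225, 232], [15, 29, 39, 51, 75, 78, 83, 89, 102, 108, 149,
   156, 165, 172, 177, 178, 210, 216, 226, 232], [29, 39, 46, 51, 71, 77, 78, 83, 89, 106, 149,
   156, 165, 172, 177, 178, 210, 216, 226, 232]]

/-- The certificate `c` identifies `F` with one of the listed spheres. -/
def certifies (c : ℕ) (F : List ℕ) : Bool :=
  Nat.beq (relabel c 255) 255 && Nat.blt (c >>> 24) 39 &&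
    Nat.beq (key (F.map (relabel c))) (key (spheres.getD (c >>> 24) []))

/-- Add the facet `f` with ridges `r` to a partial facet list and continue with `k`. -/
def addFacet {β : Type} (k : List ℕ → ℕ → ℕ → List ℕ → Option β) (F : List ℕ) (o w : ℕ)
    (cs : List ℕ) (z : Option β) (f r : ℕ) : Option β :=
  bif fold (fun g b => bif Nat.beq f g then true else b) false F then z else
  force (Nat.xor o r) fun o' =>
  bif bad f (f :: F) o' then z else
  force (Nat.lor w (Nat.land o r)) fun w' => k (f :: F) o' w' cs

/-- Add the facet `f` to a partial facet list unless it contains a ridge in `w`. -/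
def tryFacet {β : Type} (k : List ℕ → ℕ → ℕ → List ℕ → Option β) (F : List ℕ) (o w : ℕ)
    (cs : List ℕ) (z : Option β) (f : ℕ) : Option β :=
  force (ridges f) fun r =>
  bif Nat.beq (Nat.land w r) (nat_lit 0) then addFacet k F o w cs z f r else z

/-- Use the first certificate for the complete list `F`. -/
def useCert (F cs : List ℕ) : Option (List ℕ) :=
  List.rec none (fun c cs _ => bif certifies c F then some cs else none) cs

/-- Continue with the facet `t ||| 2 ^ x`, provided that the label `x` is in `u`. -/
def branch (k : List ℕ → ℕ → ℕ → List ℕ → Option (List ℕ)) (F : List ℕ) (o w t u x : ℕ)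
    (acc : Option (List ℕ)) : Option (List ℕ) :=
  bif tb t x then acc else
  bif tb u x then
    Option.rec none (fun cs =>
      force (Nat.lor t (Nat.shiftLeft (nat_lit 1) x)) (tryFacet k F o w cs (some cs))) acc
  else acc

/-- Complete the partial facet list `F` in all possible ways, where `o` and `w` record
the ridges contained in an odd number of members of `F`, respectively in at least two members.
The complete lists are identified by successive members of `cs`; the unused certificates are
returned. -/
def search (n : ℕ) : List ℕ → ℕ → ℕ → List ℕ → Option (List ℕ) :=
  Nat.rec (fun _ _ _ _ => none)
    (fun _ ih F o w cs =>
      force (span F (nat_lit 0)) fun u =>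
      bif Nat.beq o (nat_lit 0) then
        bif Nat.beq u (nat_lit 255) then useCert F cs else some cs
      else
        force o.log2 fun t =>
        force (Nat.lor u (Nat.shiftLeft (nat_lit 1) (Nat.log2 (Nat.xor u (nat_lit 255))))) fun u' =>
        fold (branch ih F o w t u') (some cs) labels) n

/-- Certificates for the complete lists found by `search`. -/
def certificates : List ℕ :=
  [42803112, 116516168, 217165128, 401712040, 368160072, 502377576, 552709224, 631190184,
   496841605, 538917537, 647967400, 116501608, 250733896, 351397192, 501343564, 501329004,
   569486405, 608632067, 569500685, 608628259, 217179240, 401708400, 368174184, 502392136,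
   552723784, 631183184, 496834101, 538924817, 647960400, 133276584, 267494312, 387892122,
   317825960, 468923496, 496317319, 569748548, 633854083, 537351959, 609152545, 267490672,
   387881202, 317822320, 468920136, 546648967, 609156353, 496309815, 569762828, 633850387,
   111011144, 9248680, 99724616, 211630977, 390225019, 228451656, 110893747, 200387688, 384937029,
   334619976, 485614696, 519154757, 598080784, 485511859, 514049937, 616755987, 498197960,
   312305165, 454909209, 566040368, 624602848, 616498961, 539151834, 200299411, 384992147,
   396264346, 211586394, 480066433, 513749161, 600457025, 329157722, 480021850, 605699753,
   504755470, 312381682, 454867370, 548617857, 625933576, 498081459, 565995722, 616343750,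
   435283272, 558664125, 535947912, 560663164, 418491720, 558824705, 580708176, 435165875,
   560624454, 211660104, 396207016, 94219592, 9342865, 111098497, 329100392, 479992723, 480095560,
   513664013, 600427464, 504871089, 605724323, 211557267, 396123219, 370138273, 200445018,
   418462593, 560489319, 558881160, 558636335, 435370625, 536032577, 560712304, 435193182,
   580852418, 548529608, 463297561, 633280272, 312268310, 611043952, 566167313, 498107870,
   384906152, 200356741, 110921054, 228539009, 463253930, 312418537, 498286209, 539123603,
   616327370, 621977491, 566012102, 519123880, 598194562, 472072034, 334707329, 616814682,
   513965258, 485655646, 362655048, 496872552, 547204200, 636695208, 502346629, 551762593,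
   653472424, 217136001, 386555003, 116603521, 42773957, 496348280, 569717664, 633795864,
   317799493, 467757793, 620179617, 537323770, 387865683, 261905491, 133250117, 546679928,
   609212808, 468806337, 317766278, 636957344, 569847969, 496279806, 267434630, 387766038,
   501298085, 569455528, 608688536, 351484545, 501430945, 619917481, 569585833, 250821249,
   116470661, 552811137, 634320136, 502479489, 368259717, 645591824, 538896586, 496804078,
   217264773, 401652358, 110996584, 233956680, 334605416, 485497747, 485600584, 519169037,
   593087432, 514046129, 616734371, 498183288, 566047648, 624620824, 312294469, 454912737,
   616509601, 539158778, 9270128, 110908307, 200402248, 384951309, 99738728, 211637809, 390228939,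
   200284851, 384995507, 312378266, 498103187, 565988442, 616350750, 454870898, 548632081,
   625929824, 435268712, 558678517, 535944272, 580697256, 435180435, 560602670, 560681420,
   418505832, 558820897, 396267762, 211607786, 480073265, 513738577, 600471081, 605714257,
   513583814, 329179338, 480043242, 245228872, 116398771, 217062291, 401628243, 400710739,
   267410515, 116413331, 42753482, 133196427, 217076403, 401631883, 400714379, 267414155,
   351294355, 501371795, 569541523, 619876531, 501357235, 569544883, 619873171, 502289299,
   362581338, 496929882, 552620947, 641169168, 636650163, 547261530, 569770899, 620105907,
   496471130, 317742163, 636883347, 546824394, 467802838, 502274739, 551703443, 641398544,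
   636653971, 547283146, 362602730, 496951498, 569774259, 620102547, 636879539, 546802778,
   468720342, 496492746, 317745803, 345892168, 488498508, 488483948, 563981381, 606797059,
   563995661, 606793251, 194882664, 379432005, 375643297, 194939994, 127745093, 194897224,
   379446285, 127691403, 26180225, 375646993, 194961610, 127755789, 452060488, 577167828,
   577146044, 577227944, 446642817, 573529634, 577235280, 446649873, 573537026, 563895386,
   614257694, 488557658, 345934938, 614227034, 563926046, 488424798, 194807134, 379376670,
   563899082, 614247110, 614230730, 563915462, 488417518, 488564938, 345956554, 379366086,
   194814190, 211674216, 396203376, 329114952, 480109672, 513649733, 590740752, 480006835,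
   504874897, 605745939, 412957569, 558654311, 560716168, 560471343, 429865601, 530527553,
   558877296, 429688158, 586357442, 548514936, 611047816, 463301313, 312261254, 633287328,
   566177953, 498114814, 94233704, 211571379, 396126859, 370141969, 200466634, 9367729, 111105553,
   384898928, 200349237, 463243122, 548434835, 621998771, 616320090, 566019102, 312411481,
   498300433, 519116656, 598197810, 616811210, 519072458, 485662926, 472086314, 334714385,
   110928110, 228546065, 362669160, 496887112, 547218760, 636688208, 502339125, 551769873,
   653465424, 496362952, 317810189, 467754265, 569710384, 633777888, 620168977, 537316826,
   546694600, 468802585, 636950288, 317773334, 609208944, 569837329, 496272862, 261929606,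
   400611094, 217142833, 386558923, 387869323, 261909131, 133260813, 116610577, 42787901,
   501290805, 569448304, 608684784, 619906897, 569575249, 351491601, 501438225, 552818193,
   634302048, 653727504, 538889306, 496797022, 502486545, 368252437, 401659414, 217257493,
   250828305, 116463157, 127771560, 194794387, 379487123, 379401128, 194851717, 488453029,
   563950504, 606853528, 345979521, 488585889, 614412457, 564080809, 194779827, 379490483,
   345789331, 488526739, 564036499, 614371507, 488512179, 564039859, 614368147, 446555464,
   573497812, 573476028, 573557928, 452147841, 577199650, 573565264, 452154897, 577207042,
   379393904, 194844213, 488445749, 563943280, 606849776, 614401873, 564070225, 345986577,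
   488593169, 26207560, 127862105, 194984577, 379531433, 127869161, 194991633, 379520849,
   261989288, 400737178, 401769370, 217091418, 116426078, 245316225, 317883290, 496268179,
   569658458, 620020766, 467715954, 546797073, 627764832, 496784275, 368086362, 502434906,
   547115923, 648509200, 631145139, 552766554, 569400410, 619762718, 501402714, 351439962,
   619732058, 569431070, 501269854, 468748146, 546599827, 629338803, 619990106, 569689118,
   317916505, 496465425, 547313169, 628797024, 650057488, 551734362, 502302046, 496981521,
   362747413, 133367129, 42897297, 116558938, 267584857, 400770393, 401802585, 217220190,
   312320936, 463418472, 498152327, 566078532, 624679043, 539186967, 610987553, 485571457,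
   519254185, 593116993, 334662746, 485526874, 616709801, 513930510, 234044033, 110965637,
   429763688, 560513525, 530439248, 586202280, 429675411, 558767662, 558846412, 413000808,
   560655905, 566100883, 616435891, 498306138, 312237139, 633213331, 548659402, 454957782,
   200312158, 384881694, 513611632, 590857778, 605801162, 513567434, 480157902, 470251306,
   329209361, 396154390, 211752469, 200489601, 385036457, 111053914, 9415238, 390287193,
   211722446, 99824261, 261985648, 400726258, 317886706, 467712426, 546782849, 627768584,
   496246451, 569665738, 620013766, 468758954, 317923561, 496451201, 537288595, 619997386,
   629317523, 569682118, 547306113, 628815112, 496974465, 362754693, 651096848, 551741642,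
   502309102, 401772786, 217112810, 496769715, 538858387, 650573584, 631148947, 552788170,
   368107754, 502456522, 569404106, 619752134, 619735754, 569420486, 501262574, 501409994,
   351461578, 116433134, 245323281, 133374185, 262079833, 387925337, 386617177, 217227470,
   42922161, 116580554, 312317296, 463415112, 548483975, 610991361, 498144823, 566092812,
   624675347, 429778248, 560499133, 530442888, 558828156, 412986696, 560659713, 586213200,
   429660851, 558789446, 513618856, 590854530, 470237026, 329202305, 605804634, 504790218,
   480150622, 211759749, 396147334, 485578289, 519243601, 593131049, 616724305, 519088838,
   334684362, 485548266, 566104243, 616432531, 633209523, 548637786, 463215318, 498327754,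
   312240779, 384871110, 200319214, 234051089, 110958133, 200496657, 385025873, 396297561,
   211715166, 94319237, 111075530, 9425934, 59702408, 177020840, 177042288, 307460808, 478101673,
   307453528, 478087505, 177187440, 343055544, 307488584, 478045225, 307422168, 477915921,
   307404024, 477912225, 307287992, 478053793, 160767875, 301210780, 406404064, 544764714,
   301237660, 406433632, 544966762, 177198472, 343073744, 307477608, 478031169, 343139656,
   160726155, 301327372, 301313092, 406485712, 544916418, 406478488, 544905274, 307280880,
   478060849, 160789043, 301228756, 406411064, 544743266, 301244660, 406451496, 544981322,
   177142920, 343105104, 343112328, 307360680, 477973377, 160925067, 301412492, 301282180,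
   406570832, 544890434, 406504920, 544788794, 307339120, 477976625, 160931955, 301401684,
   406497528, 544771042, 301274676, 406567080, 544897546, 175185832, 76357544, 291719823,
   458178895, 494354575, 320653170, 192743793, 291661135, 458123791, 444505248, 554744762,
   554802554, 494298127, 320740082, 192686897, 424862456, 506673848, 555031867, 424892024,
   506586488, 555002299, 278834369, 420949603, 420832227, 444093921, 292276750, 493517326,
   444239521, 292188494, 493601102, 325248460, 191933424, 460579496, 511599657, 594234305,
   493086028, 293069836, 175910185, 419773414, 510181870, 555329913, 458651150, 320220913,
   77343977, 192159538, 325279372, 191962992, 493058700, 460551272, 511656105, 594177857,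
   293040268, 175966633, 419802982, 510271022, 555301689, 458735822, 320161777, 77399977,
   192186866, 175207280, 286214799, 460013903, 76378992, 192758185, 494340183, 320649642,
   325233788, 191944120, 460561744, 511585601, 589192401, 424844760, 506681296, 555049955,
   192697761, 77358425, 192181154, 286170279, 458120263, 444523280, 554751986, 554820586,
   494283847, 320754586, 493071468, 293055556, 423902182, 506053102, 175924577, 320239001,
   555337193, 458636870, 424885192, 506572264, 555009523, 278848537, 420967691, 444083001,
   420814139, 292280390, 493510214, 444264721, 285654694, 493586542, 325286484, 493051476,
   191984552, 77410673, 192201146, 460533576, 511641937, 594181161, 293015124, 175980913,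
   320158137, 424067550, 555309025, 510292806, 459784534, 175352432, 286156111, 459958799,
   319728764, 460389264, 511527809, 589219729, 424730520, 555167331, 506654416, 76524144,
   192060600, 192818217, 494166807, 320707882, 192842913, 77531801, 192384098, 325313364,
   493020116, 192130152, 77441585, 192289850, 460417992, 511470353, 589129513, 292840404,
   176040497, 320187705, 424042014, 555396833, 510380614, 459700758, 286053799, 458146695,
   444553296, 554868466, 554909290, 492925868, 494224263, 320785498, 292909956, 423989094,
   506084910, 176097953, 320326809, 555368105, 458605510, 424800072, 506544040, 555097779,
   278876313, 444139897, 420997259, 420784571, 292221702, 493536198, 444323857, 285595110,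
   493384494, 175363464, 319743436, 291675303, 459955271, 424737520, 555185419, 506657944,
   460381872, 511531057, 594185697, 319808340, 493001916, 494148775, 320725858, 460414072,
   511466657, 589118817, 292822204, 424049350, 555414809, 176051585, 320202209, 510384142,
   459693702, 76535176, 192078800, 192832833, 192144712, 77452673, 192308162, 192864529, 77549777,
   192405770, 286042935, 458135607, 492904308, 444549768, 554890138, 554923850, 424803432,
   555119507, 506558320, 278858449, 444154345, 420990035, 444320385, 285584190, 493363046,
   420791795, 292199974, 493525054, 494213175, 320792778, 292888116, 419874270, 506099526,
   555382609, 458594366, 176115985, 320334033, 175307912, 319774348, 319781460, 291558823,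
   459981703, 492885436, 424908656, 555214987, 506713496, 460494320, 511615281, 594042785,
   460497848, 511608225, 589147041, 494175655, 320813666, 292849084, 424134470, 555473049,
   176082049, 320290465, 510325006, 459720134, 291547959, 459970615, 492874740, 424915880,
   555207763, 506702576, 444491080, 554949722, 554953418, 278685521, 444214825, 444233025,
   420901779, 292064062, 493390822, 420880051, 292082150, 493408574, 494182711, 320821002,
   292856308, 419847838, 555469521, 506186438, 459712574, 176089105, 320304913, 76479624,
   192110160, 192117384, 192891521, 77511809, 192368194, 192894993, 77522449, 192378890,
   138369232]

section Specifications

theorem fold_cons {β : Type} (g : ℕ → β → β) (z : β) (a : ℕ) (l : List ℕ) :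
    fold g z (a :: l) = g a (fold g z l) := rfl

theorem force_eq {β : Type} (n : ℕ) (k : ℕ → β) : force n k = k n := by
  cases n <;> rfl

theorem tb_eq (m i : ℕ) : tb m i = m.testBit i := by
  have : tb m i = ((m >>> i) &&& 1).beq 1 := rfl
  rw [this, Nat.testBit, Nat.and_comm 1, Nat.and_one_is_mod]
  rcases Nat.mod_two_eq_zero_or_one (m >>> i) with h | h <;> rw [h] <;> rfl

/-- The set of labels in a mask. -/
def bits (m : ℕ) : Finset ℕ := (Finset.range 8).filter (fun i => m.testBit i)

theorem mem_bits {m i : ℕ} : i ∈ bits m ↔ i < 8 ∧ m.testBit i := by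
  simp [bits]

theorem lt_eight_of_testBit {m i : ℕ} (hm : m < 256) (h : m.testBit i) : i < 8 := by
  by_contra! hi
  rw [Nat.testBit_lt_two_pow (hm.trans_le (Nat.pow_le_pow_right (n := 2) (by simp) hi))] at h
  exact absurd h (by simp)

theorem mem_bits_of_lt {m i : ℕ} (hm : m < 256) : i ∈ bits m ↔ m.testBit i :=
  mem_bits.trans (and_iff_right_of_imp (lt_eight_of_testBit hm))

theorem mem_labels {i : ℕ} : i ∈ labels ↔ i < 8 := by
  constructor
  · intro h
    have : ∀ i ∈ labels, i < 8 := by decide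
    exact this i h
  · intro h
    interval_cases i <;> decide

theorem bits_injOn {m n : ℕ} (hm : m < 256) (hn : n < 256) (h : bits m = bits n) : m = n := by
  refine Nat.eq_of_testBit_eq fun i => ?_
  rw [Bool.eq_iff_iff, ← mem_bits_of_lt hm, ← mem_bits_of_lt hn, h]

theorem sub_iff {m n : ℕ} (hm : m < 256) : sub m n = true ↔ bits m ⊆ bits n := by
  have : sub m n = (m &&& n).beq m := rfl
  rw [this, Nat.beq_eq]
  constructor
  · intro h i hi
    rw [mem_bits] at hi ⊢
    rw [← h, Nat.testBit_and, Bool.and_eq_true] at hi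
    exact ⟨hi.1, hi.2.2⟩
  · intro h
    refine Nat.eq_of_testBit_eq fun i => ?_
    rw [Nat.testBit_and, Bool.eq_iff_iff, Bool.and_eq_true, and_iff_left_iff_imp,
      ← mem_bits_of_lt hm]
    exact fun hi => (mem_bits.1 (h hi)).2

theorem bits_zero : bits 0 = ∅ := by simp [bits]

theorem testBit_shift {i j : ℕ} : (Nat.shiftLeft 1 i).testBit j ↔ j = i := by
  change (1 <<< i).testBit j ↔ _
  rw [Nat.one_shiftLeft, Nat.testBit_two_pow, decide_eq_true_eq, eq_comm]

theorem bits_shift {i : ℕ} (hi : i < 8) : bits (Nat.shiftLeft 1 i) = {i} := by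
  ext j
  rw [mem_bits, testBit_shift, Finset.mem_singleton]
  omega

theorem shift_lt {i : ℕ} (hi : i < 8) : Nat.shiftLeft 1 i < 256 := by
  interval_cases i <;> decide

theorem lor_lt {m n : ℕ} (hm : m < 256) (hn : n < 256) : Nat.lor m n < 256 :=
  Nat.or_lt_two_pow (n := 8) hm hn

theorem testBit_lor {m n i : ℕ} : (Nat.lor m n).testBit i ↔ m.testBit i ∨ n.testBit i := by
  rw [← Bool.or_eq_true, ← Nat.testBit_or]
  rfl

theorem testBit_land {m n i : ℕ} : (Nat.land m n).testBit i ↔ m.testBit i ∧ n.testBit i := by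
  rw [← Bool.and_eq_true, ← Nat.testBit_and]
  rfl

theorem testBit_xor {m n i : ℕ} :
    (Nat.xor m n).testBit i ↔ ¬(m.testBit i ↔ n.testBit i) := by
  change (m ^^^ n).testBit i ↔ _
  rw [Nat.testBit_xor, Bool.xor_iff_ne, Ne, Bool.eq_iff_iff]

theorem bits_lor {m n : ℕ} : bits (Nat.lor m n) = bits m ∪ bits n := by
  ext i
  simp only [mem_bits, Finset.mem_union, testBit_lor]
  tauto

theorem bits_land {m n : ℕ} : bits (Nat.land m n) = bits m ∩ bits n := by
  ext i
  simp only [mem_bits, Finset.mem_inter, testBit_land]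
  tauto

theorem bits_insert {m i : ℕ} (hi : i < 8) :
    bits (Nat.lor m (Nat.shiftLeft 1 i)) = insert i (bits m) := by
  rw [bits_lor, bits_shift hi, Finset.union_comm]
  rfl

theorem exists_bits {s : Finset ℕ} (hs : s ⊆ Finset.range 8) : ∃ m < 256, bits m = s := by
  induction s using Finset.induction_on with
  | empty => exact ⟨0, by simp, bits_zero⟩
  | insert i s _ ih =>
    rw [Finset.insert_subset_iff, Finset.mem_range] at hs
    obtain ⟨m, hm, rfl⟩ := ih hs.2
    exact ⟨_, lor_lt hm (shift_lt hs.1), bits_insert hs.1⟩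

theorem testBit_maskOf {g : ℕ → ℕ} {m j : ℕ} :
    (maskOf g m).testBit j ↔ ∃ i ∈ bits m, g i = j := by
  have : ∀ l : List ℕ, (fold (fun i a => bif tb m i then
      Nat.lor a (Nat.shiftLeft 1 (g i)) else a) 0 l).testBit j ↔
      ∃ i ∈ l, m.testBit i ∧ g i = j := by
    intro l
    induction l with
    | nil => simp [fold]
    | cons i l ih =>
      rw [fold_cons, tb_eq, List.exists_mem_cons_iff, ← ih]
      cases h : m.testBit i
      · simp
      · rw [cond_true, testBit_lor, testBit_shift, or_comm, eq_comm]
        simp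
  refine (this labels).trans (exists_congr fun i => ?_)
  rw [mem_labels, mem_bits, and_assoc]

theorem bits_flip {f i : ℕ} (hi : i ∈ bits f) : bits (flip f i) = (bits f).erase i := by
  ext j
  have : f.testBit i := (mem_bits.1 hi).2
  rw [flip, mem_bits, testBit_xor, testBit_shift, Finset.mem_erase, mem_bits]
  by_cases h : j = i
  · subst h; simp [this]
  · simp [h]

theorem flip_lt {f i : ℕ} (hf : f < 256) (hi : i < 8) : flip f i < 256 :=
  Nat.xor_lt_two_pow (n := 8) hf (shift_lt hi)

theorem testBit_ridges {f t : ℕ} (hf : f < 256) : (ridges f).testBit t ↔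
    t < 256 ∧ bits t ⊆ bits f ∧ (bits t).card + 1 = (bits f).card := by
  rw [ridges, testBit_maskOf]
  constructor
  · rintro ⟨i, hi, rfl⟩
    refine ⟨flip_lt hf (mem_bits.1 hi).1, ?_⟩
    rw [bits_flip hi]
    exact ⟨Finset.erase_subset _ _, Finset.card_erase_add_one hi⟩
  · rintro ⟨ht, hs, hc⟩
    obtain ⟨i, hi⟩ := Finset.card_eq_one.1
      (show (bits f \ bits t).card = 1 by rw [Finset.card_sdiff_of_subset hs]; omega)
    have hif : i ∈ bits f \ bits t := by simp [hi]
    rw [Finset.mem_sdiff] at hif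
    refine ⟨i, hif.1, bits_injOn (flip_lt hf (mem_bits.1 hif.1).1) ht ?_⟩
    rw [bits_flip hif.1, ← Finset.sdiff_singleton_eq_erase, ← hi, Finset.sdiff_sdiff_eq_self hs]

theorem fold_succ (p : ℕ → Bool) (l : List ℕ) :
    fold (fun i a => bif p i then Nat.succ a else a) 0 l = l.countP p := by
  induction l with
  | nil => rfl
  | cons i l ih => rw [fold_cons, ih, List.countP_cons]; cases p i <;> rfl

theorem pop_eq (m : ℕ) : pop m = (bits m).card := by
  have h : bits m = (labels.filter (fun i => m.testBit i)).toFinset := by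
    ext i
    rw [mem_bits, List.mem_toFinset, List.mem_filter, mem_labels]
  rw [h, List.toFinset_card_of_nodup (List.Nodup.filter _ (by decide)),
    ← List.countP_eq_length_filter]
  simp only [← tb_eq]
  exact fold_succ _ _

/-- The facet set given by a list of masks. -/
def cx (F : List ℕ) : Finset (Finset ℕ) := (F.map bits).toFinset

theorem mem_cx {F : List ℕ} {a : Finset ℕ} : a ∈ cx F ↔ ∃ f ∈ F, bits f = a := by
  simp [cx]

theorem bits_mem_cx {F : List ℕ} {f : ℕ} (hf : f ∈ F) : bits f ∈ cx F := mem_cx.2 ⟨f, hf, rfl⟩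

theorem testBit_span {F : List ℕ} {s i : ℕ} :
    (span F s).testBit i ↔ ∃ f ∈ F, sub s f ∧ f.testBit i := by
  induction F with
  | nil => simp [span, fold]
  | cons f F ih =>
    rw [span, fold_cons, List.exists_mem_cons_iff, ← ih]
    cases h : sub s f
    · simp [span]
    · rw [cond_true, testBit_lor]
      simp [span]

theorem bits_span {F : List ℕ} {s : ℕ} (hs : s < 256) :
    bits (span F s) = ((cx F).filter (bits s ⊆ ·)).sup id := by
  ext i
  simp only [mem_bits, testBit_span, Finset.mem_sup, Finset.mem_filter, mem_cx, id]
  constructor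
  · rintro ⟨hi, f, hf, hsf, hif⟩
    exact ⟨bits f, ⟨⟨f, hf, rfl⟩, (sub_iff hs).1 hsf⟩, mem_bits.2 ⟨hi, hif⟩⟩
  · rintro ⟨_, ⟨⟨f, hf, rfl⟩, hsf⟩, hif⟩
    exact ⟨(mem_bits.1 hif).1, f, hf, (sub_iff hs).2 hsf, (mem_bits.1 hif).2⟩

theorem deg_eq {F : List ℕ} {s : ℕ} (hs : s < 256) :
    deg F s = facetDegree (cx F) (bits s) := by
  rw [deg, force_eq, force_eq, pop_eq, facetDegree, ← bits_span hs]
  congr 1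
  ext i
  rw [mem_bits, testBit_land, testBit_xor, Finset.mem_sdiff, mem_bits, mem_bits]
  tauto

theorem count_eq {F : List ℕ} {s : ℕ} (hs : s < 256) (hF : ∀ f ∈ F, f < 256) (hn : F.Nodup) :
    count F s = ((cx F).filter (bits s ⊆ ·)).card := by
  have h : (cx F).filter (bits s ⊆ ·) = ((F.filter (sub s)).map bits).toFinset := by
    ext a
    simp only [Finset.mem_filter, mem_cx, List.mem_toFinset, List.mem_map, List.mem_filter]
    constructor
    · rintro ⟨⟨f, hf, rfl⟩, h⟩
      exact ⟨f, ⟨hf, (sub_iff hs).2 h⟩, rfl⟩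
    · rintro ⟨f, ⟨hf, h⟩, rfl⟩
      exact ⟨⟨f, hf, rfl⟩, (sub_iff hs).1 h⟩
  rw [h, List.toFinset_card_of_nodup, List.length_map, ← List.countP_eq_length_filter]
  · exact fold_succ _ _
  · refine List.Nodup.map_on ?_ (hn.filter _)
    intro f hf g hg
    exact bits_injOn (hF f (List.mem_filter.1 hf).1) (hF g (List.mem_filter.1 hg).1)

theorem testBit_key {F : List ℕ} {m : ℕ} : (key F).testBit m ↔ m ∈ F := by
  induction F with
  | nil => simp [key, fold]
  | cons f F ih =>
    rw [key, fold_cons, testBit_lor, testBit_shift, List.mem_cons, ← ih, or_comm]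
    rfl

theorem cx_eq_of_key {F G : List ℕ} (h : key F = key G) : cx F = cx G := by
  ext a
  simp only [mem_cx, ← testBit_key, h]

theorem bits_relabel (c m : ℕ) : bits (relabel c m) =
    (bits m).image (fun i => Nat.land (Nat.shiftRight c (Nat.mul 3 i)) 7) := by
  ext j
  rw [mem_bits, relabel, testBit_maskOf, Finset.mem_image, and_iff_right_of_imp]
  rintro ⟨i, -, rfl⟩
  exact Nat.lt_succ_of_le (Nat.and_le_right (n := _) (m := 7))

end Specifications

section Soundness

/-- Some facet list in `spheres` is isomorphic to `Φ`. -/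
def Listed (Φ : Finset (Finset ℕ)) : Prop :=
  ∃ X ∈ spheres, ∃ f : ℕ → ℕ, Set.InjOn f ↑(Φ.sup id) ∧ Φ.image (Finset.image f) = cx X

/-- `F` is a list of distinct masks of members of `Φ`. -/
structure IsSublist (F : List ℕ) (Φ : Finset (Finset ℕ)) : Prop where
  lt : ∀ f ∈ F, f < 256
  nodup : F.Nodup
  mem : ∀ f ∈ F, bits f ∈ Φ

/-- The number of members of `F` having the ridge `t`. -/
def ridgeCount (F : List ℕ) (t : ℕ) : ℕ := F.countP (fun f => (ridges f).testBit t)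

/-- The invariant of `search`. -/
structure IsPartial (F : List ℕ) (o w : ℕ) (Φ : Finset (Finset ℕ)) : Prop
    extends IsSublist F Φ where
  base : 240 ∈ F
  odd : ∀ t, o.testBit t ↔ Odd (ridgeCount F t)
  two : ∀ t, w.testBit t → 2 ≤ ridgeCount F t

variable {F : List ℕ} {o w : ℕ} {Φ : Finset (Finset ℕ)}

theorem IsSublist.cx_subset (h : IsSublist F Φ) : cx F ⊆ Φ := by
  intro a ha
  obtain ⟨f, hf, rfl⟩ := mem_cx.1 ha
  exact h.mem f hf

theorem IsSublist.of_ridgeCount_pos (h : IsSublist F Φ) (hΦ : Normalised Φ) {t : ℕ}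
    (ht : 0 < ridgeCount F t) :
    t < 256 ∧ (bits t).card = 3 ∧ ∃ a ∈ cx F, bits t ⊆ a := by
  obtain ⟨f, hf, hft⟩ := List.countP_pos_iff.1 ht
  obtain ⟨h1, h2, h3⟩ := (testBit_ridges (h.lt f hf)).1 hft
  rw [hΦ.card _ (h.mem f hf)] at h3
  exact ⟨h1, by omega, bits f, bits_mem_cx hf, h2⟩

theorem IsSublist.ridgeCount_eq (h : IsSublist F Φ) (hΦ : Normalised Φ) {t : ℕ}
    (ht : t < 256) (hc : (bits t).card = 3) :
    ridgeCount F t = ((cx F).filter (bits t ⊆ ·)).card := by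
  rw [← count_eq ht h.lt h.nodup, count, fold_succ]
  refine List.countP_congr fun f hf => ?_
  rw [testBit_ridges (h.lt f hf), sub_iff ht, hΦ.card _ (h.mem f hf), hc]
  simp [ht]

theorem IsSublist.ridgeCount_le (h : IsSublist F Φ) (hΦ : Normalised Φ) (t : ℕ) :
    ridgeCount F t ≤ 2 := by
  by_contra! hcon
  obtain ⟨ht, hc, a, ha, hta⟩ := h.of_ridgeCount_pos hΦ (by omega : 0 < ridgeCount F t)
  rw [h.ridgeCount_eq hΦ ht hc, ← hΦ.ridge (bits t) hc a (h.cx_subset ha) hta] at hcon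
  exact hcon.not_ge (Finset.card_le_card (Finset.filter_subset_filter _ h.cx_subset))

theorem IsPartial.exists_facet (h : IsPartial F o w Φ) (hΦ : Normalised Φ) {t : ℕ}
    (ht : o.testBit t) : t < 256 ∧ (bits t).card = 3 ∧ ∃ a ∈ Φ, bits t ⊆ a ∧ a ∉ cx F := by
  have hodd := (h.odd t).1 ht
  have hS := h.toIsSublist
  obtain ⟨ht, hc, a, ha, hta⟩ := hS.of_ridgeCount_pos hΦ hodd.pos
  refine ⟨ht, hc, ?_⟩
  by_contra! hcon
  have heq : (cx F).filter (bits t ⊆ ·) = Φ.filter (bits t ⊆ ·) := by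
    refine (Finset.filter_subset_filter _ hS.cx_subset).antisymm fun b hb => ?_
    rw [Finset.mem_filter] at hb ⊢
    exact ⟨hcon b hb.1 hb.2, hb.2⟩
  rw [hS.ridgeCount_eq hΦ ht hc, heq, hΦ.ridge (bits t) hc a (hS.cx_subset ha) hta] at hodd
  exact absurd hodd (by decide)

theorem IsPartial.filter_eq (h : IsPartial F o w Φ) (hΦ : Normalised Φ) {σ : Finset ℕ}
    (hσ : σ.card ≤ 2) (ho : ∀ t, o.testBit t → ¬ σ ⊆ bits t) {a : Finset ℕ} (ha : a ∈ cx F)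
    (hσa : σ ⊆ a) : (cx F).filter (σ ⊆ ·) = Φ.filter (σ ⊆ ·) := by
  have hS := h.toIsSublist
  refine (Finset.filter_subset_filter _ hS.cx_subset).antisymm fun b hb => ?_
  rw [Finset.mem_filter] at hb ⊢
  refine ⟨?_, hb.2⟩
  refine hΦ.star σ hσ {b | b ∈ cx F} a (hS.cx_subset ha) hσa ha ?_ b hb.1 hb.2
  intro b hbΦ c hcΦ hσb hσc hb hbc
  obtain ⟨f, hf, rfl⟩ := mem_cx.1 hb
  obtain ⟨t, ht, htb⟩ := exists_bits
    (show bits f ∩ c ⊆ Finset.range 8 from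
      Finset.inter_subset_left.trans (Finset.filter_subset _ _))
  rw [← htb] at hbc
  have hfc := Finset.subset_inter_iff.1 htb.le
  have hclosed := mt (h.odd t).2 fun hot => ho t hot (htb ▸ Finset.subset_inter hσb hσc)
  have hcount := hS.ridgeCount_eq hΦ ht hbc
  have hle := hS.ridgeCount_le hΦ t
  have hpos : 0 < ((cx F).filter (bits t ⊆ ·)).card :=
    Finset.card_pos.2 ⟨_, Finset.mem_filter.2 ⟨hb, hfc.1⟩⟩
  have heq : (cx F).filter (bits t ⊆ ·) = Φ.filter (bits t ⊆ ·) := by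
    refine Finset.eq_of_subset_of_card_le (Finset.filter_subset_filter _ hS.cx_subset) ?_
    rw [hΦ.ridge (bits t) hbc _ hbΦ hfc.1]
    rw [Nat.not_odd_iff_even] at hclosed
    obtain ⟨r, hr⟩ := hclosed
    omega
  have : c ∈ Φ.filter (bits t ⊆ ·) := Finset.mem_filter.2 ⟨hcΦ, hfc.2⟩
  rw [← heq] at this
  exact (Finset.mem_filter.1 this).1

theorem facetDegree_mono {Ψ : Finset (Finset ℕ)} (h : Ψ ⊆ Φ) (σ : Finset ℕ) :
    facetDegree Ψ σ ≤ facetDegree Φ σ :=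
  Finset.card_le_card (Finset.sdiff_subset_sdiff
    (Finset.sup_mono (Finset.filter_subset_filter _ h)) le_rfl)

theorem testBit_stars : ∀ i < 8, ∀ t < 256, (stars.getD i 0).testBit t = t.testBit i := by
  decide +kernel

theorem testBit_lastStar : ∀ t < 256, lastStar.testBit t = t.testBit 7 := by
  decide +kernel

theorem testBit_lastEdgeStar :
    ∀ t < 256, lastEdgeStar.testBit t = (t.testBit 7 && t.testBit 6) := by
  decide +kernel

theorem not_testBit_of_land {m n t : ℕ} (h : Nat.land m n = 0) (ht : m.testBit t) :
    n.testBit t = false := by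
  have := testBit_land (m := m) (n := n) (i := t)
  rw [h] at this
  simpa [ht] using this

theorem fold_any {p : ℕ → Bool} {z : Bool} {l : List ℕ} (hp : ∀ i ∈ l, p i = false) :
    fold (fun i b => bif p i then true else b) z l = z := by
  induction l with
  | nil => rfl
  | cons i l ih =>
    rw [fold_cons, hp i (by simp)]
    exact ih fun j hj => hp j (by simp [hj])

theorem exceeds_eq_false {m s r : ℕ}
    (h : ∀ i < 8, m.testBit i → deg F (Nat.lor s (Nat.shiftLeft 1 i)) ≤ deg F r) :
    exceeds F m s r = false := by
  rw [exceeds, force_eq]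
  cases Nat.beq (deg F r) 7
  · rw [cond_false]
    refine Eq.trans (congrArg (fun g => fold g false labels) ?_) (fold_any (l := labels)
      (p := fun i => tb m i && !Nat.ble (deg F (Nat.lor s (Nat.shiftLeft 1 i))) (deg F r)) ?_)
    · funext i b
      rw [force_eq]
      cases tb m i <;> cases Nat.ble (deg F (Nat.lor s (Nat.shiftLeft 1 i))) (deg F r) <;> rfl
    · intro i hi
      cases hm : m.testBit i
      · simp [tb_eq, hm]
      · simpa using fun _ => h i (mem_labels.1 hi) hm
  · rfl

theorem bits_base : bits 240 = {4, 5, 6, 7} := by decide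

theorem IsPartial.badVertex_eq_false (h : IsPartial F o w Φ) (hΦ : Normalised Φ) {f i : ℕ}
    (hf : f ∈ F) (hi : i < 8) : badVertex f F o i = false := by
  rw [badVertex, tb_eq, force_eq]
  cases hfi : f.testBit i
  · rfl
  cases ho : Nat.beq (Nat.land o (stars.getD i 0)) 0
  · rfl
  rw [Nat.beq_eq] at ho
  have hif : i ∈ bits f := mem_bits.2 ⟨hi, hfi⟩
  have heq : (cx F).filter ({i} ⊆ ·) = Φ.filter ({i} ⊆ ·) := by
    refine h.filter_eq hΦ (by simp) (fun t ht => ?_) (bits_mem_cx hf) (by simpa using hif)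
    have := not_testBit_of_land ho ht
    rw [testBit_stars i hi t (h.exists_facet hΦ ht).1] at this
    simp [mem_bits, this]
  have he := hΦ.euler i (subset_sup_id (h.mem f hf) hif)
  rw [facetDegree, ← heq, ← facetDegree] at he
  rw [count_eq (shift_lt hi) h.lt h.nodup, deg_eq (shift_lt hi), bits_shift hi]
  simp only [cond_true, Bool.not_eq_false', Nat.beq_eq]
  exact he

theorem IsPartial.bad_eq_false (h : IsPartial F o w Φ) (hΦ : Normalised Φ) {f : ℕ} (hf : f ∈ F) :
    bad f F o = false := by
  have hbase := bits_mem_cx h.base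
  have hle := facetDegree_mono h.cx_subset
  rw [bad, fold_any fun i hi => h.badVertex_eq_false hΦ hf (mem_labels.1 hi)]
  cases ho : Nat.beq (Nat.land o lastStar) 0
  · cases ho' : Nat.beq (Nat.land o lastEdgeStar) 0
    · rfl
    rw [Nat.beq_eq] at ho'
    have heq : (cx F).filter ({7, 6} ⊆ ·) = Φ.filter ({7, 6} ⊆ ·) := by
      refine h.filter_eq hΦ (by simp) (fun t ht hs => ?_) hbase (by rw [bits_base]; decide)
      have := not_testBit_of_land ho' ht
      rw [testBit_lastEdgeStar t (h.exists_facet hΦ ht).1] at this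
      rw [Finset.insert_subset_iff, Finset.singleton_subset_iff, mem_bits, mem_bits] at hs
      simp [hs] at this
    refine exceeds_eq_false fun i hi him => ?_
    rw [deg_eq (lor_lt (by simp) (shift_lt hi)), deg_eq (by simp), bits_insert hi,
      show bits 128 = {7} by decide, show bits 192 = {7, 6} by decide, Finset.pair_comm]
    refine (hle _).trans ((hΦ.edge i ?_).trans_eq ?_)
    · interval_cases i <;> first | decide | exact absurd him (by decide)
    · rw [facetDegree, ← heq, ← facetDegree]
  · rw [Nat.beq_eq] at ho
    have heq : (cx F).filter ({7} ⊆ ·) = Φ.filter ({7} ⊆ ·) := by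
      refine h.filter_eq hΦ (by simp) (fun t ht => ?_) hbase (by rw [bits_base]; decide)
      have := not_testBit_of_land ho ht
      rw [testBit_lastStar t (h.exists_facet hΦ ht).1] at this
      simp [mem_bits, this]
    refine exceeds_eq_false fun i hi _ => ?_
    rw [deg_eq (lor_lt (by simp) (shift_lt hi)), deg_eq (by simp), bits_insert hi,
      show bits 128 = {7} by decide, bits_zero, insert_empty_eq]
    refine (hle _).trans ((hΦ.vertex i hi).trans_eq ?_)
    rw [facetDegree, ← heq, ← facetDegree]

theorem ridgeCount_cons (f : ℕ) (F : List ℕ) (t : ℕ) :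
    ridgeCount (f :: F) t = ridgeCount F t + if (ridges f).testBit t then 1 else 0 :=
  List.countP_cons

theorem IsPartial.cons (h : IsPartial F o w Φ) (hΦ : Normalised Φ) {f : ℕ} (hf : f < 256)
    (hmem : bits f ∈ Φ) (hnot : f ∉ F) : Nat.land w (ridges f) = 0 ∧
    IsPartial (f :: F) (Nat.xor o (ridges f)) (Nat.lor w (Nat.land o (ridges f))) Φ := by
  have hS : IsSublist (f :: F) Φ :=
    ⟨by simpa [hf] using h.lt, List.nodup_cons.2 ⟨hnot, h.nodup⟩, by simpa [hmem] using h.mem⟩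
  refine ⟨?_, hS, by simp [h.base], fun t => ?_, fun t ht => ?_⟩
  · refine Nat.eq_of_testBit_eq fun t => ?_
    rw [Nat.zero_testBit, Bool.eq_false_iff, Ne, testBit_land]
    rintro ⟨hw, hr⟩
    have h1 := h.two t hw
    have h2 := hS.ridgeCount_le hΦ t
    rw [ridgeCount_cons, if_pos hr] at h2
    omega
  · rw [testBit_xor, h.odd, ridgeCount_cons]
    cases hr : (ridges f).testBit t
    · simp
    · simp [Nat.odd_add_one]
  · rw [ridgeCount_cons]
    rw [testBit_lor, testBit_land, h.odd] at ht
    rcases ht with ht | ⟨ht, hr⟩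
    · exact (h.two t ht).trans (Nat.le_add_right _ _)
    · rw [if_pos hr]
      have := ht.pos
      omega

theorem Listed.of_image {f : ℕ → ℕ} (hf : Set.InjOn f ↑(Φ.sup id))
    (h : Listed (Φ.image (Finset.image f))) : Listed Φ := by
  obtain ⟨X, hX, g, hg, hgX⟩ := h
  rw [sup_image_image, Finset.coe_image] at hg
  refine ⟨X, hX, g ∘ f, hg.comp hf (Set.mapsTo_image _ _), ?_⟩
  rw [← hgX, Finset.image_image]
  refine Finset.image_congr fun a _ => ?_
  exact Finset.image_image.symm

theorem Normalised.image_swap (hΦ : Normalised Φ) {x y : ℕ} (hx : x < 6) (hy : y < 6) :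
    Normalised (Φ.image (Finset.image (Equiv.swap x y))) := by
  have hinj : Set.InjOn (Equiv.swap x y) ↑(Φ.sup id) := (Equiv.injective _).injOn
  have h7 : Equiv.swap x y 7 = 7 := Equiv.swap_apply_of_ne_of_ne (by omega) (by omega)
  have h6 : Equiv.swap x y 6 = 6 := Equiv.swap_apply_of_ne_of_ne (by omega) (by omega)
  have hlt : ∀ i, ∀ n, 6 ≤ n → i < n → Equiv.swap x y i < n := by
    intro i n hn hi
    rw [Equiv.swap_apply_def]
    split_ifs <;> omega
  have hdeg : ∀ σ ⊆ Finset.range 8, facetDegree (Φ.image (Finset.image (Equiv.swap x y)))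
      (σ.image (Equiv.swap x y)) = facetDegree Φ σ := fun σ hσ =>
    facetDegree_image_image hinj (hΦ.verts ▸ hσ)
  refine ⟨hΦ.image_image hinj, ?_, ?_, ?_⟩
  · rw [sup_image_image, hΦ.verts]
    refine Finset.eq_of_subset_of_card_le ?_ ?_
    · intro i hi
      obtain ⟨j, hj, rfl⟩ := Finset.mem_image.1 hi
      exact Finset.mem_range.2 (hlt j 8 (by simp) (Finset.mem_range.1 hj))
    · rw [Finset.card_image_of_injective _ (Equiv.injective _)]
  · intro i hi
    have h1 := hdeg {Equiv.swap x y i} (by simpa using hlt i 8 (by simp) hi)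
    have h2 := hdeg {7} (by simp)
    simp only [Finset.image_singleton, Equiv.swap_apply_self, h7] at h1 h2
    rw [h1, h2]
    exact hΦ.vertex _ (hlt i 8 (by simp) hi)
  · intro i hi
    have h1 := hdeg {7, Equiv.swap x y i} (by
      simpa [Finset.insert_subset_iff] using hlt i 8 (by simp) (by omega))
    have h2 := hdeg {7, 6} (by simp [Finset.insert_subset_iff])
    simp only [Finset.image_insert, Finset.image_singleton, Equiv.swap_apply_self, h7, h6] at h1 h2
    rw [h1, h2]
    exact hΦ.edge _ (hlt i 7 (by simp) hi)

theorem listed_of_certifies {c : ℕ} (hv : (cx F).sup id = Finset.range 8)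
    (h : certifies c F = true) : Listed (cx F) := by
  simp only [certifies, Bool.and_eq_true, Nat.beq_eq] at h
  obtain ⟨⟨h1, h2⟩, h3⟩ := h
  have h2 : c >>> 24 < spheres.length := by simpa [spheres] using h2
  rw [List.getD_eq_getElem _ _ h2] at h3
  refine ⟨spheres[c >>> 24], List.getElem_mem h2,
    fun i => Nat.land (Nat.shiftRight c (Nat.mul 3 i)) 7, ?_, ?_⟩
  · rw [hv]
    refine Finset.card_image_iff.1 ?_
    have h255 : bits 255 = Finset.range 8 := by decide
    rw [← h255, ← bits_relabel, h1]
  · rw [← cx_eq_of_key h3]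
    ext a
    simp only [Finset.mem_image, mem_cx, List.mem_map, exists_exists_and_eq_and, bits_relabel]

theorem fold_branch {k : List ℕ → ℕ → ℕ → List ℕ → Option (List ℕ)} {cs cs' l : List ℕ}
    {t u x : ℕ} (h : fold (branch k F o w t u) (some cs) l = some cs') (hx : x ∈ l)
    (hxt : ¬ t.testBit x) (hxu : u.testBit x) : ∃ c c',
      tryFacet k F o w c (some c) (Nat.lor t (Nat.shiftLeft 1 x)) = some c' := by
  have hnone : ∀ y, branch k F o w t u y none = none := by
    intro y
    rw [branch]
    cases tb t y <;> cases tb u y <;> rfl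
  induction l generalizing cs' with
  | nil => simp at hx
  | cons y l ih =>
    rw [fold_cons] at h
    cases hacc : fold (branch k F o w t u) (some cs) l with
    | none => rw [hacc, hnone] at h; exact absurd h (by simp)
    | some c =>
      rcases List.mem_cons.1 hx with rfl | hx
      · simp only [hacc, branch, tb_eq, Bool.eq_false_iff.2 hxt, hxu, cond_false, cond_true,
          force_eq] at h
        exact ⟨c, cs', h⟩
      · exact ih hacc hx

theorem listed_of_useCert {cs cs' : List ℕ} (hv : (cx F).sup id = Finset.range 8)
    (h : useCert F cs = some cs') : Listed (cx F) := by
  cases cs with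
  | nil => exact absurd h (by simp [useCert])
  | cons c cs =>
    cases hc : certifies c F
    · simp [useCert, hc] at h
    · exact listed_of_certifies hv hc

theorem IsPartial.listed_of_tryFacet {k : List ℕ → ℕ → ℕ → List ℕ → Option (List ℕ)}
    {cs cs' : List ℕ} {f : ℕ} (h : IsPartial F o w Φ) (hΦ : Normalised Φ)
    (hk : ∀ F o w cs cs', k F o w cs = some cs' → IsPartial F o w Φ → Listed Φ)
    (hf : f < 256) (hmem : bits f ∈ Φ) (hnot : bits f ∉ cx F)
    (ht : tryFacet k F o w cs (some cs) f = some cs') : Listed Φ := by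
  have hfF : f ∉ F := fun h => hnot (bits_mem_cx h)
  obtain ⟨hw, hp⟩ := h.cons hΦ hf hmem hfF
  rw [tryFacet, force_eq, hw, addFacet, force_eq, force_eq, hp.bad_eq_false hΦ (by simp),
    fold_any] at ht
  · exact hk _ _ _ _ _ ht hp
  · intro g hg
    rw [Bool.eq_false_iff, Ne, Nat.beq_eq]
    rintro rfl
    exact hfF hg

theorem search_succ (n : ℕ) (F : List ℕ) (o w : ℕ) (cs : List ℕ) : search (n + 1) F o w cs =
    bif Nat.beq o 0 then bif Nat.beq (span F 0) 255 then useCert F cs else some cs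
    else fold (branch (search n) F o w o.log2
      (Nat.lor (span F 0) (Nat.shiftLeft 1 (Nat.log2 (Nat.xor (span F 0) 255)))))
      (some cs) labels := by
  rw [← force_eq (Nat.lor (span F 0) _)
    fun u => fold (branch (search n) F o w o.log2 u) (some cs) labels,
    ← force_eq o.log2 fun t => force _ fun u => fold (branch (search n) F o w t u) (some cs) labels,
    ← force_eq (span F 0) fun u => bif Nat.beq o 0 then
      bif Nat.beq u 255 then useCert F cs else some cs else force o.log2 fun t =>
        force (Nat.lor u (Nat.shiftLeft 1 (Nat.log2 (Nat.xor u 255)))) fun u' =>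
          fold (branch (search n) F o w t u') (some cs) labels]
  rfl

theorem listed_of_search {n : ℕ} {cs cs' : List ℕ} (hs : search n F o w cs = some cs')
    (h : IsPartial F o w Φ) (hΦ : Normalised Φ) : Listed Φ := by
  induction n generalizing F o w cs cs' Φ with
  | zero => exact absurd hs (by simp [search])
  | succ n ih =>
    have hS := h.toIsSublist
    have hspan := bits_span (F := F) (s := 0) (by simp)
    simp only [bits_zero, Finset.empty_subset, Finset.filter_true] at hspan
    have hspan8 : span F 0 < 256 := by
      refine Nat.lt_pow_two_of_testBit (n := 8) _ fun i hi => ?_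
      rw [Bool.eq_false_iff, Ne, testBit_span]
      rintro ⟨f, hf, -, hif⟩
      exact absurd (lt_eight_of_testBit (h.lt f hf) hif) (by omega)
    rw [search_succ] at hs
    cases ho : Nat.beq o 0
    · rw [ho, cond_false] at hs
      set t := o.log2
      set u := span F 0
      set y := Nat.log2 (Nat.xor u 255)
      have hot : o.testBit t := Nat.testBit_log2 (by
        rintro rfl
        exact absurd ho (by simp))
      obtain ⟨ht, htc, a, ha, hta, haF⟩ := h.exists_facet hΦ hot
      obtain ⟨x, hx⟩ := Finset.card_eq_one.1 (show (a \ bits t).card = 1 by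
        rw [Finset.card_sdiff_of_subset hta, hΦ.card a ha, htc])
      have hxa : x ∈ a \ bits t := by simp [hx]
      have hax : a = insert x (bits t) := by
        rw [← Finset.sdiff_union_of_subset hta, hx]
        rfl
      rw [Finset.mem_sdiff] at hxa
      have hx8 : x < 8 := by
        rw [← Finset.mem_range, ← hΦ.verts]
        exact subset_sup_id ha hxa.1
      have htest : ∀ z < 8, z ∉ bits t → ¬ t.testBit z := fun z hz hzt htz =>
        hzt (mem_bits.2 ⟨hz, htz⟩)
      have hadd : ∀ z < 8, (Nat.lor t (Nat.shiftLeft 1 z)) < 256 := fun z hz =>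
        lor_lt ht (shift_lt hz)
      by_cases hxu : u.testBit x
      · obtain ⟨c, c', hc⟩ := fold_branch hs (mem_labels.2 hx8) (htest x hx8 hxa.2)
          (testBit_lor.2 (.inl hxu))
        refine h.listed_of_tryFacet hΦ (fun _ _ _ _ _ hs h => ih hs h hΦ) (hadd x hx8) ?_ ?_ hc
        · rwa [bits_insert hx8, ← hax]
        · rwa [bits_insert hx8, ← hax]
      · have hne : Nat.xor u 255 ≠ 0 := by
          intro h0
          have := testBit_xor (m := u) (n := 255) (i := x)
          rw [h0, Nat.zero_testBit] at this
          have h255 : (255 : ℕ).testBit x := by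
            rw [show 255 = 2 ^ 8 - 1 by rfl, Nat.testBit_two_pow_sub_one]
            simpa
          simp [hxu, h255] at this
        have hy8 : y < 8 := lt_eight_of_testBit
          (Nat.xor_lt_two_pow (n := 8) hspan8 (by simp)) (Nat.testBit_log2 hne)
        have hyu : ¬ u.testBit y := by
          have := testBit_xor.1 (Nat.testBit_log2 hne)
          have h255 : (255 : ℕ).testBit y := by
            rw [show 255 = 2 ^ 8 - 1 by rfl, Nat.testBit_two_pow_sub_one]
            simpa
          tauto
        have hold : ∀ z < 8, ¬ u.testBit z → ∀ f ∈ F, z ∉ bits f := by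
          intro z hz hzu f hf hzf
          exact hzu (testBit_span.2 ⟨f, hf, by simp [sub, Nat.land], (mem_bits.1 hzf).2⟩)
        have h6 : ∀ z < 8, ¬ u.testBit z → z < 6 := by
          intro z hz hzu
          have := hold z hz hzu 240 h.base
          rw [bits_base] at this
          simp at this
          omega
        have hfix : ∀ s : Finset ℕ, x ∉ s → y ∉ s → s.image (Equiv.swap x y) = s := by
          intro s hxs hys
          conv_rhs => rw [← Finset.image_id (s := s)]
          refine Finset.image_congr fun z hz => Equiv.swap_apply_of_ne_of_ne ?_ ?_
          · rintro rfl; exact hxs hz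
          · rintro rfl; exact hys hz
        have hsub : bits t ⊆ bits u := by
          obtain ⟨-, -, b, hb, htb⟩ := hS.of_ridgeCount_pos hΦ ((h.odd t).1 hot).pos
          exact htb.trans (hspan ▸ subset_sup_id hb)
        have hyt : y ∉ bits t := fun hy => hyu (mem_bits.1 (hsub hy)).2
        have himg : insert y (bits t) = a.image (Equiv.swap x y) := by
          rw [hax, Finset.image_insert, Equiv.swap_apply_left, hfix _ hxa.2 hyt]
        have hΨ := hΦ.image_swap (h6 x hx8 hxu) (h6 y hy8 hyu)
        have hp : IsPartial F o w (Φ.image (Finset.image (Equiv.swap x y))) := by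
          refine ⟨⟨h.lt, h.nodup, fun f hf => ?_⟩, h.base, h.odd, h.two⟩
          exact Finset.mem_image.2
            ⟨_, h.mem f hf, hfix _ (hold x hx8 hxu f hf) (hold y hy8 hyu f hf)⟩
        refine Listed.of_image (f := Equiv.swap x y) (Equiv.injective _).injOn ?_
        obtain ⟨c, c', hc⟩ := fold_branch hs (mem_labels.2 hy8) (htest y hy8 hyt)
          (testBit_lor.2 (.inr (testBit_shift.2 rfl)))
        refine hp.listed_of_tryFacet hΨ (fun _ _ _ _ _ hs h => ih hs h hΨ) (hadd y hy8) ?_ ?_ hc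
        · rw [bits_insert hy8, himg]
          exact Finset.mem_image_of_mem _ ha
        · rw [bits_insert hy8]
          intro hmem
          obtain ⟨f, hf, hfy⟩ := mem_cx.1 hmem
          exact hold y hy8 hyu f hf (by simp [hfy])
    · rw [Nat.beq_eq] at ho
      subst ho
      have hcx : cx F = Φ := by
        have := h.filter_eq hΦ (σ := ∅) (by simp) (by simp) (bits_mem_cx h.base) (by simp)
        simpa using this
      have hv : (cx F).sup id = Finset.range 8 := hcx ▸ hΦ.verts
      have h255 : span F 0 = 255 := by
        refine bits_injOn hspan8 (by simp) ?_
        rw [hspan, hv]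
        decide
      rw [h255] at hs
      exact hcx ▸ listed_of_useCert hv hs

end Soundness

/-- Add to the ridges in `R` those of the members of `F` that share a ridge with `R` or with
an earlier addition. -/
def touch (F : List ℕ) (R : ℕ) : ℕ :=
  fold (fun f a => force (ridges f) fun r => force a fun a =>
    bif Nat.beq (Nat.land a r) 0 then a else Nat.lor a r) R F

/-- Three rounds of `touch` reach all members of `F` from the first one. -/
def connected (F : List ℕ) : Bool :=
  force (touch F (touch F (touch F (ridges (F.headD 0))))) fun R =>
    F.all fun f => !Nat.beq (Nat.land R (ridges f)) 0

/-- The test that `F` lists the facets of a 3-manifold on the vertices `0, …, 7`. -/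
def valid (F : List ℕ) : Bool :=
  F.all (fun f => Nat.blt f 256 && Nat.beq (pop f) 4) && decide F.Nodup &&
  Nat.beq (span F 0) 255 &&
  F.all (fun f => labels.all fun i => !tb f i || Nat.beq (count F (flip f i)) 2) &&
  labels.all (fun i => force (Nat.shiftLeft 1 i) fun s =>
    Nat.beq (Nat.add (count F s) 4) (Nat.mul 2 (deg F s))) &&
  (List.range 256).all fun s => !Nat.ble (pop s) 2 || connected (F.filter (sub s))

section Validity

variable {F : List ℕ} {P : ℕ → Prop}

theorem exists_testBit_of_land {m n : ℕ} (h : Nat.beq (Nat.land m n) 0 = false) :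
    ∃ t, m.testBit t ∧ n.testBit t := by
  by_contra! hcon
  rw [Bool.eq_false_iff, Ne, Nat.beq_eq] at h
  refine h (Nat.eq_of_testBit_eq fun t => ?_)
  rw [Nat.zero_testBit, Bool.eq_false_iff, Ne, testBit_land]
  exact fun ht => hcon t ht.1 ht.2

theorem exists_of_testBit_touch
    (hP : ∀ b ∈ F, ∀ c ∈ F, ∀ t, P b → (ridges b).testBit t → (ridges c).testBit t → P c) {R : ℕ}
    (hR : ∀ t, R.testBit t → ∃ b ∈ F, P b ∧ (ridges b).testBit t) {t : ℕ}
    (ht : (touch F R).testBit t) : ∃ b ∈ F, P b ∧ (ridges b).testBit t := by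
  suffices H : ∀ G ⊆ F, ∀ t, (touch G R).testBit t → ∃ b ∈ F, P b ∧ (ridges b).testBit t from
    H F (List.Subset.refl F) t ht
  intro G
  induction G with
  | nil => exact fun _ => hR
  | cons g G ih =>
    intro hG t ht
    have ih := ih (List.subset_of_cons_subset hG)
    rw [touch, fold_cons, force_eq, force_eq] at ht
    change (bif Nat.beq (Nat.land (touch G R) (ridges g)) 0 then touch G R
      else Nat.lor (touch G R) (ridges g)).testBit t at ht
    cases h : Nat.beq (Nat.land (touch G R) (ridges g)) 0
    · rw [h, cond_false, testBit_lor] at ht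
      refine ht.elim (ih t) fun ht => ?_
      obtain ⟨t', h1, h2⟩ := exists_testBit_of_land h
      obtain ⟨b, hb, hPb, hbt⟩ := ih t' h1
      have hg : g ∈ F := hG (by simp)
      exact ⟨g, hg, hP b hb g hg t' hPb hbt h2, ht⟩
    · rw [h, cond_true] at ht
      exact ih t ht

theorem forall_of_connected (h : connected F = true)
    (hP : ∀ b ∈ F, ∀ c ∈ F, ∀ t, P b → (ridges b).testBit t → (ridges c).testBit t → P c)
    (h0 : P (F.headD 0)) : ∀ b ∈ F, P b := by
  cases F with
  | nil => simp
  | cons a F =>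
    intro b hb
    rw [connected, force_eq, List.all_eq_true] at h
    obtain ⟨t, h1, h2⟩ := exists_testBit_of_land (by simpa using h b hb)
    obtain ⟨c, hc, hPc, hct⟩ := exists_of_testBit_touch hP (fun t => exists_of_testBit_touch hP
      (fun t => exists_of_testBit_touch hP fun t ht => ⟨a, by simp, h0, ht⟩)) h1
    exact hP c hc b hb t hPc hct h2

theorem starConn_of_connected (hlt : ∀ f ∈ F, f < 256) (hc : ∀ f ∈ F, (bits f).card = 4) {s : ℕ}
    (hs : s < 256) (h : connected (F.filter (sub s)) = true) : StarConn (cx F) 3 (bits s) := by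
  intro S a ha hsa haS hS
  have hmem : ∀ {f}, f ∈ F.filter (sub s) ↔ f ∈ F ∧ bits s ⊆ bits f := by
    simp [sub_iff hs]
  have hall := forall_of_connected h
    (P := fun b => bits b ∈ S ↔ bits ((F.filter (sub s)).headD 0) ∈ S) ?_ Iff.rfl
  · obtain ⟨f, hf, rfl⟩ := mem_cx.1 ha
    intro c hc hsc
    obtain ⟨g, hg, rfl⟩ := mem_cx.1 hc
    exact (hall g (hmem.2 ⟨hg, hsc⟩)).2 ((hall f (hmem.2 ⟨hf, hsa⟩)).1 haS)
  · intro b hb c hc' t hPb hbt hct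
    obtain ⟨hb, hsb⟩ := hmem.1 hb
    obtain ⟨hc', hsc⟩ := hmem.1 hc'
    obtain ⟨-, hb1, hb2⟩ := (testBit_ridges (hlt b hb)).1 hbt
    obtain ⟨-, hc1, hc2⟩ := (testBit_ridges (hlt c hc')).1 hct
    rw [hc b hb] at hb2
    have hle := Finset.card_le_card (Finset.subset_inter hb1 hc1)
    by_cases heq : bits b = bits c
    · rwa [← heq]
    have hne : (bits b ∩ bits c).card ≠ 4 := fun h4 => heq <|
      (Finset.eq_of_subset_of_card_le Finset.inter_subset_left (by rw [h4, hc b hb])).symm.trans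
        (Finset.eq_of_subset_of_card_le Finset.inter_subset_right (by rw [h4, hc c hc']))
    have hle' := Finset.card_le_card (Finset.inter_subset_left (s₁ := bits b) (s₂ := bits c))
    rw [hc b hb] at hle'
    have h3 : (bits b ∩ bits c).card = 3 := by omega
    rw [← hPb]
    exact ⟨fun h => hS _ (bits_mem_cx hc') _ (bits_mem_cx hb) hsc hsb h
        (by rwa [Finset.inter_comm]),
      fun h => hS _ (bits_mem_cx hb) _ (bits_mem_cx hc') hsb hsc h h3⟩

theorem verts_of_valid (h : valid F = true) : (cx F).sup id = Finset.range 8 := by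
  simp only [valid, Bool.and_eq_true, Nat.beq_eq] at h
  have := bits_span (F := F) (s := 0) (by simp)
  rw [h.1.1.1.2] at this
  simp only [bits_zero, Finset.empty_subset, Finset.filter_true] at this
  rw [← this]
  decide

theorem mfdFacets_of_valid (h : valid F = true) : MfdFacets (cx F) := by
  have hv := verts_of_valid h
  simp only [valid, Bool.and_eq_true, List.all_eq_true, Nat.beq_eq, decide_eq_true_eq,
    Bool.or_eq_true, Bool.not_eq_true', force_eq, Nat.blt_eq, pop_eq, tb_eq, List.mem_range,
    mem_labels] at h
  obtain ⟨⟨⟨⟨⟨h4, hnd⟩, -⟩, hridge⟩, heuler⟩, hstar⟩ := h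
  have hlt := fun f hf => (h4 f hf).1
  have hcard := fun f hf => (h4 f hf).2
  refine ⟨?_, ?_, ?_, ?_, ?_⟩
  · rw [Finset.nonempty_iff_ne_empty]
    intro h
    rw [h] at hv
    exact absurd hv (by decide)
  · intro a ha
    obtain ⟨f, hf, rfl⟩ := mem_cx.1 ha
    exact hcard f hf
  · intro τ hτ a ha hs
    obtain ⟨f, hf, rfl⟩ := mem_cx.1 ha
    obtain ⟨t, ht, rfl⟩ := exists_bits (hs.trans (Finset.filter_subset _ _))
    have htr : (ridges f).testBit t :=
      (testBit_ridges (hlt f hf)).2 ⟨ht, hs, by rw [hτ, hcard f hf]⟩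
    obtain ⟨i, hi, rfl⟩ := testBit_maskOf.1 htr
    obtain ⟨hi, hfi⟩ := mem_bits.1 hi
    rw [← count_eq ht hlt hnd]
    simpa [hfi] using hridge f hf i hi
  · intro σ hσ S a ha hsa
    obtain ⟨f, hf, rfl⟩ := mem_cx.1 ha
    obtain ⟨s, hs, rfl⟩ := exists_bits (hsa.trans (Finset.filter_subset _ _))
    refine starConn_of_connected hlt hcard hs ?_ S _ ha hsa
    refine (hstar s hs).resolve_left ?_
    simpa using hσ
  · intro v hvm
    rw [hv, Finset.mem_range] at hvm
    have := heuler v hvm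
    rw [count_eq (shift_lt hvm) hlt hnd, deg_eq (shift_lt hvm), bits_shift hvm] at this
    exact this

set_option maxRecDepth 100000 in
theorem valid_of_mem_spheres : ∀ X ∈ spheres, valid X = true := by decide +kernel

end Validity

/-- An isomorphism invariant of 3-dimensional complexes. -/
def weight {α : Type*} [DecidableEq α] (K : Complex α) : ℕ :=
  ∑ σ ∈ K, (∑ ρ ∈ facets K 3, 2 ^ (σ ∩ ρ).card) ^ 2

/-- The value of `weight` on the complex with facets `F`. -/
def listWeight (F : List ℕ) : ℕ :=
  fold (fun m a => bif !Nat.beq m 0 && F.any (sub m) then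
    Nat.add a (Nat.pow (fold (fun f b => Nat.add (Nat.pow 2 (pop (Nat.land m f))) b) 0 F) 2)
    else a) 0 (List.range 256)

section Weight

theorem weight_image {α β : Type*} [DecidableEq α] [DecidableEq β] {K : Complex α} {f : α → β}
    (hf : Set.InjOn f ↑(verts K)) : weight (K.image fun σ => σ.image f) = weight K := by
  have hsub : ∀ {σ}, σ ∈ K → (σ : Set α) ⊆ verts K := fun h =>
    Finset.coe_subset.2 (Finset.le_sup (f := id) h)
  have hinj : Set.InjOn (fun σ : Finset α => σ.image f) K :=
    (image_injOn_of_injOn hf).mono fun _ hσ => Finset.coe_subset.1 (hsub hσ)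
  have hfacets : facets (K.image fun σ => σ.image f) 3 =
      (facets K 3).image fun σ => σ.image f := by
    rw [facets, facets, Finset.filter_image]
    congr 1
    refine Finset.filter_congr fun σ hσ => ?_
    rw [Finset.card_image_of_injOn (hf.mono (hsub hσ))]
  rw [weight, weight, Finset.sum_image hinj, hfacets]
  refine Finset.sum_congr rfl fun σ hσ => ?_
  rw [Finset.sum_image (hinj.mono (s₁ := facets K 3) fun _ hρ => (Finset.mem_filter.1 hρ).1)]
  congr 1
  refine Finset.sum_congr rfl fun ρ hρ => ?_
  have hρ := (Finset.mem_filter.1 hρ).1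
  rw [← Finset.image_inter_of_injOn _ _
      (hf.mono (Set.union_subset (hsub hσ) (hsub hρ))),
    Finset.card_image_of_injOn (hf.mono fun x hx => hsub hσ (Finset.mem_inter.1 hx).1)]

theorem fold_add (g : ℕ → ℕ) (l : List ℕ) :
    fold (fun i a => Nat.add (g i) a) 0 l = (l.map g).sum := by
  induction l with
  | nil => rfl
  | cons i l ih => rw [fold_cons, ih, List.map_cons, List.sum_cons]; rfl

theorem fold_add_filter (p : ℕ → Bool) (g : ℕ → ℕ) (l : List ℕ) :
    fold (fun i a => bif p i then Nat.add a (g i) else a) 0 l = ((l.filter p).map g).sum := by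
  induction l with
  | nil => rfl
  | cons i l ih =>
    rw [fold_cons, ih]
    cases h : p i
    · simp [h]
    · simpa [h] using Nat.add_comm _ _

theorem sum_cx {F : List ℕ} (hlt : ∀ f ∈ F, f < 256) (hn : F.Nodup) (g : Finset ℕ → ℕ) :
    ∑ a ∈ cx F, g a = (F.map fun f => g (bits f)).sum := by
  rw [cx, List.sum_toFinset, List.map_map]
  · rfl
  · exact hn.map_on fun a ha b hb => bits_injOn (hlt a ha) (hlt b hb)

theorem weight_genCx_cx {F : List ℕ} (h : valid F = true) :
    weight (genCx (cx F)) = listWeight F := by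
  have hc := (mfdFacets_of_valid h).card
  simp only [valid, Bool.and_eq_true, List.all_eq_true, decide_eq_true_eq, Nat.blt_eq] at h
  obtain ⟨⟨⟨⟨⟨h4, hnd⟩, -⟩, -⟩, -⟩, -⟩ := h
  have hlt := fun f hf => (h4 f hf).1
  have hgen : genCx (cx F) =
      cx ((List.range 256).filter fun m => !Nat.beq m 0 && F.any (sub m)) := by
    ext σ
    simp only [mem_genCx, mem_cx, List.mem_filter, List.mem_range, Bool.and_eq_true,
      List.any_eq_true, Bool.not_eq_true', exists_exists_and_eq_and]
    constructor
    · rintro ⟨hne, f, hf, hσ⟩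
      obtain ⟨m, hm, rfl⟩ := exists_bits (hσ.trans (Finset.filter_subset _ _))
      refine ⟨m, ⟨hm, ?_, f, hf, (sub_iff hm).2 hσ⟩, rfl⟩
      rw [Bool.eq_false_iff, Ne, Nat.beq_eq]
      rintro rfl
      simp [bits_zero] at hne
    · rintro ⟨m, ⟨hm, h0, f, hf, hs⟩, rfl⟩
      refine ⟨?_, f, hf, (sub_iff hm).1 hs⟩
      rw [Finset.nonempty_iff_ne_empty, ← bits_zero]
      intro h
      rw [bits_injOn hm (by simp) h] at h0
      exact absurd h0 (by decide)
  rw [weight, facets_genCx hc, hgen, sum_cx, listWeight, fold_add_filter]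
  · congr 2
    funext m
    rw [sum_cx hlt hnd, fold_add]
    simp only [pop_eq, bits_land]
    rfl
  · intro m hm
    exact List.mem_range.1 (List.mem_filter.1 hm).1
  · exact List.nodup_range.filter _

set_option maxRecDepth 100000 in
theorem pairwise_listWeight : spheres.Pairwise fun X Y => listWeight X ≠ listWeight Y := by
  have : (spheres.map listWeight).Nodup := by decide +kernel
  exact List.pairwise_map.1 this

theorem not_iso_of_listWeight_ne {F G : List ℕ} (hF : valid F = true) (hG : valid G = true)
    (h : listWeight F ≠ listWeight G) : ¬ Iso (genCx (cx F)) (genCx (cx G)) := by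
  rintro ⟨f, hf, hfG⟩
  rw [← weight_genCx_cx hF, ← weight_genCx_cx hG, hfG, weight_image hf] at h
  exact h rfl

end Weight

/-- The test that the bistellar move replacing `A` by `B` applies to the complex with
facets `F`. -/
def movable (F : List ℕ) (A B : ℕ) : Bool :=
  F.all (fun f => Nat.beq (pop f) 4) && Nat.blt A 256 && Nat.blt B 256 &&
  Nat.beq (Nat.add (pop A) (pop B)) 5 && Nat.ble 2 (pop B) && Nat.ble (pop B) 4 &&
  F.any (sub A) && !F.any (sub B) &&
  Nat.beq (key ((F.filter (sub A)).map (Nat.xor A))) (ridges B)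

/-- The facets after the bistellar move replacing `A` by `B`. -/
def move (F : List ℕ) (A B : ℕ) : List ℕ :=
  F.filter (fun f => !sub A f) ++ (labels.filter (tb A)).map (flip (Nat.lor A B))

/-- The moves `p` lead from the complex with facets `F` to the standard sphere. -/
def reduces (p : List (ℕ × ℕ)) : List ℕ → Bool :=
  List.rec (fun F => Nat.beq (key F) (ridges 31))
    (fun m _ ih F => movable F m.1 m.2 && ih (move F m.1 m.2)) p

/-- Sequences of bistellar moves that reduce the members of `spheres`. -/
def paths : List (List (ℕ × ℕ)) :=
  [[(64, 27), (128, 60), (32, 29)], [(32, 89), (128, 92), (64, 29)], [(32, 153), (64, 27), (128,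
   29)], [(96, 25), (32, 153), (64, 27), (128, 29)], [(32, 216), (192, 25), (64, 27), (128, 29)],
   [(32, 149), (64, 154), (130, 25), (128, 29)], [(32, 209), (64, 153), (130, 21), (128, 29)],
   [(32, 147), (64, 149), (130, 25), (128, 29)], [(224, 3), (96, 7), (160, 11), (32, 15), (192,
   19), (64, 23), (128, 27)], [(96, 19), (64, 27), (160, 21), (32, 23), (128, 29)], [(33, 208),
   (32, 216), (192, 25), (64, 27), (128, 29)], [(64, 184), (160, 25), (32, 27), (130, 21), (128,
   29)], [(32, 149), (65, 138), (64, 154), (130, 25), (128, 29)], [(65, 56), (64, 184), (32, 153),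
   (130, 21), (128, 29)], [(65, 168), (64, 184), (32, 153), (130, 21), (128, 29)], [(64, 149),
   (160, 19), (32, 23), (130, 25), (128, 29)], [(192, 49), (96, 19), (64, 27), (160, 21), (32,
   23), (128, 29)], [(96, 137), (64, 153), (33, 138), (32, 142), (129, 26), (128, 30)], [(96, 21),
   (64, 149), (160, 19), (32, 23), (130, 25), (128, 29)], [(65, 168), (64, 184), (160, 25), (32,
   29), (129, 26), (128, 30)], [(65, 168), (64, 184), (160, 25), (32, 27), (130, 21), (128, 29)],
   [(34, 21), (32, 149), (65, 138), (64, 154), (130, 25), (128, 29)], [(64, 153), (129, 56), (130,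
   52), (128, 60), (34, 21), (32, 29)], [(64, 149), (160, 19), (33, 22), (32, 30), (130, 25),
   (128, 29)], [(96, 22), (34, 21), (32, 149), (192, 26), (64, 30), (130, 25), (128, 29)], [(34,
   21), (36, 81), (32, 209), (192, 25), (64, 29), (129, 26), (128, 30)], [(34, 137), (40, 193),
   (32, 209), (192, 25), (64, 29), (129, 26), (128, 30)], [(65, 140), (64, 156), (160, 21), (33,
   22), (32, 30), (130, 25), (128, 29)], [(65, 138), (64, 154), (130, 25), (129, 56), (128, 60),
   (34, 13), (32, 29)], [(65, 168), (64, 184), (160, 25), (33, 26), (32, 30), (130, 21), (128,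
   29)], [(96, 19), (66, 25), (64, 153), (129, 56), (130, 52), (128, 60), (34, 21), (32, 29)],
   [(33, 76), (65, 140), (96, 28), (64, 156), (160, 26), (32, 30), (130, 25), (128, 29)], [(66,
   41), (65, 168), (64, 184), (160, 25), (33, 26), (32, 30), (130, 21), (128, 29)], [(68, 41),
   (96, 137), (64, 153), (129, 56), (130, 52), (128, 60), (34, 21), (32, 29)], [(65, 50), (72,
   162), (64, 178), (129, 52), (130, 56), (128, 60), (34, 25), (32, 29)], [(96, 14), (36, 11),
   (40, 131), (32, 147), (192, 21), (65, 22), (64, 30), (130, 25), (128, 29)], [(66, 37), (68,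
   41), (96, 137), (64, 153), (129, 56), (130, 52), (128, 60), (34, 21), (32, 29)], [(65, 26),
   (68, 42), (96, 138), (64, 154), (129, 52), (130, 56), (128, 60), (33, 22), (32, 30)], [(96,
   138), (68, 11), (65, 26), (64, 154), (129, 52), (130, 56), (128, 60), (33, 22), (32, 30)]]

section Moves

variable {F : List ℕ} {A B : ℕ}

theorem genCx_eq_stdSphere {α : Type*} [DecidableEq α] {Φ : Finset (Finset α)} {s : Finset α}
    (h : ∀ a, a ∈ Φ ↔ a ⊆ s ∧ a.card + 1 = s.card) : genCx Φ = stdSphere s := by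
  ext τ
  simp only [mem_genCx, stdSphere, Finset.mem_filter, Finset.mem_powerset, h]
  constructor
  · rintro ⟨hne, a, ⟨has, hc⟩, hτ⟩
    refine ⟨hτ.trans has, hne, ?_⟩
    rintro rfl
    have := Finset.card_le_card hτ
    omega
  · rintro ⟨hs, hne, hτ⟩
    obtain ⟨x, hx, hxτ⟩ := Finset.exists_of_ssubset (hs.ssubset_of_ne hτ)
    exact ⟨hne, s.erase x, ⟨Finset.erase_subset _ _, Finset.card_erase_add_one hx⟩,
      fun y hy => Finset.mem_erase.2 ⟨fun h => hxτ (h ▸ hy), hs hy⟩⟩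

theorem mem_cx_of_key (hB : B < 256) (h : key F = ridges B) (a : Finset ℕ) :
    a ∈ cx F ↔ a ⊆ bits B ∧ a.card + 1 = (bits B).card := by
  simp only [mem_cx, ← testBit_key, h, testBit_ridges hB]
  constructor
  · rintro ⟨t, ⟨-, h⟩, rfl⟩
    exact h
  · rintro ⟨h1, h2⟩
    obtain ⟨t, ht, rfl⟩ := exists_bits (h1.trans (Finset.filter_subset _ _))
    exact ⟨t, ⟨ht, h1, h2⟩, rfl⟩

theorem bits_xor_of_subset {f : ℕ} (h : bits A ⊆ bits f) :
    bits (Nat.xor A f) = bits f \ bits A := by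
  ext i
  have := @h i
  simp only [mem_bits, testBit_xor, Finset.mem_sdiff] at this ⊢
  tauto

theorem facetLink_cx (hA : A < 256) :
    facetLink (cx F) (bits A) = cx ((F.filter (sub A)).map (Nat.xor A)) := by
  ext a
  simp only [facetLink, Finset.mem_image, Finset.mem_filter, mem_cx, List.mem_map,
    List.mem_filter, sub_iff hA]
  constructor
  · rintro ⟨_, ⟨⟨f, hf, rfl⟩, h⟩, rfl⟩
    exact ⟨_, ⟨f, ⟨hf, h⟩, rfl⟩, bits_xor_of_subset h⟩
  · rintro ⟨_, ⟨f, ⟨hf, h⟩, rfl⟩, rfl⟩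
    exact ⟨_, ⟨⟨f, hf, rfl⟩, h⟩, (bits_xor_of_subset h).symm⟩

theorem cx_move (hA : A < 256) : cx (move F A B) = (cx F).filter (fun σ => ¬ bits A ⊆ σ) ∪
    (bits A).image fun v => (bits B ∪ bits A).erase v := by
  have hflip : ∀ v ∈ bits A, bits (flip (Nat.lor A B) v) = (bits B ∪ bits A).erase v := by
    intro v hv
    rw [bits_flip (by rw [bits_lor]; exact Finset.mem_union_left _ hv), bits_lor,
      Finset.union_comm]
  have htb : ∀ v, v ∈ labels ∧ tb A v = true ↔ v ∈ bits A := fun v => by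
    rw [mem_labels, tb_eq, mem_bits]
  ext a
  simp only [mem_cx, move, List.mem_append, List.mem_filter, List.mem_map, Finset.mem_union,
    Finset.mem_filter, Finset.mem_image, Bool.not_eq_true', Bool.eq_false_iff, Ne, sub_iff hA, htb]
  constructor
  · rintro ⟨f, ⟨hf, h⟩ | ⟨v, hv, rfl⟩, rfl⟩
    · exact .inl ⟨⟨f, hf, rfl⟩, h⟩
    · exact .inr ⟨v, hv, (hflip v hv).symm⟩
  · rintro (⟨⟨f, hf, rfl⟩, h⟩ | ⟨v, hv, rfl⟩)
    · exact ⟨f, .inl ⟨hf, h⟩, rfl⟩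
    · exact ⟨_, .inr ⟨v, hv, rfl⟩, hflip v hv⟩

theorem bStep_of_movable (h : movable F A B = true) :
    BStep 3 (genCx (cx F)) (genCx (cx (move F A B))) := by
  simp only [movable, Bool.and_eq_true, List.all_eq_true, List.any_eq_true, Nat.beq_eq,
    Nat.blt_eq, Nat.ble_eq, pop_eq, Bool.not_eq_true', Nat.add_eq] at h
  obtain ⟨⟨⟨⟨⟨⟨⟨⟨hc, hA⟩, hB⟩, hAB⟩, hB2⟩, hB4⟩, f, hf, hfA⟩, hFB⟩, hkey⟩ := h
  have hcard : ∀ a ∈ cx F, a.card = 3 + 1 := by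
    intro a ha
    obtain ⟨f, hf, rfl⟩ := mem_cx.1 ha
    exact hc f hf
  refine .inr ⟨(bits B).card - 1, by omega, by omega, bits A, bits B, ?_, by omega, by omega,
    ?_, ?_, ?_⟩
  · exact mem_genCx.2 ⟨Finset.card_pos.1 (by omega), _, bits_mem_cx hf, (sub_iff hA).1 hfA⟩
  · rw [mem_genCx]
    rintro ⟨-, a, ha, hBa⟩
    obtain ⟨g, hg, rfl⟩ := mem_cx.1 ha
    rw [Bool.eq_false_iff] at hFB
    exact hFB (List.any_eq_true.2 ⟨g, hg, (sub_iff hB).2 hBa⟩)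
  · rw [link_genCx, facetLink_cx hA]
    exact genCx_eq_stdSphere (mem_cx_of_key hB hkey)
  · rw [facets_genCx hcard, cx_move hA]

theorem bEquiv_of_reduces {p : List (ℕ × ℕ)} (h : reduces p F = true) :
    BEquiv 3 (genCx (cx F)) (stdSphere {0, 1, 2, 3, 4}) := by
  induction p generalizing F with
  | nil =>
    have h31 : bits 31 = {0, 1, 2, 3, 4} := by decide
    rw [← h31, genCx_eq_stdSphere (mem_cx_of_key (by simp) (Nat.beq_eq ▸ h))]
    exact .refl
  | cons m p ih =>
    obtain ⟨h1, h2⟩ := (Bool.and_eq_true _ _ ▸ h :)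
    exact .head (bStep_of_movable h1) (ih h2)

set_option maxRecDepth 100000 in
theorem exists_reduces : ∀ X ∈ spheres, ∃ p ∈ paths, reduces p X = true := by decide +kernel

end Moves

section Classification

set_option maxRecDepth 100000 in
theorem search_eq : search 22 [240] (ridges 240) 0 certificates = some [] := by decide +kernel

theorem listed_of_base {Φ : Finset (Finset ℕ)} (hΦ : Normalised Φ) (h : {4, 5, 6, 7} ∈ Φ) :
    Listed Φ := by
  refine listed_of_search search_eq ⟨⟨by simp, by simp, ?_⟩, by simp, fun t => ?_, by simp⟩ hΦ
  · simpa [bits_base] using h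
  · cases ht : (ridges 240).testBit t <;> simp [ridgeCount, ht]

theorem exists_iso_sphere {α : Type*} [DecidableEq α] {K : Complex α} (hK : Comb3Mfd K)
    (h8 : (verts K).card = 8) : ∃ X ∈ spheres, Iso K (genCx (cx X)) := by
  have hgen : genCx (facets K 3) = K := genCx_facets hK.1.1.1 hK.1.1.2.1
  have hmfd : MfdFacets (facets K 3) :=
    (comb3Mfd_genCx_iff fun a ha => (Finset.mem_filter.1 ha).2).1 (hgen.symm ▸ hK)
  rw [← hgen, verts_genCx] at h8
  obtain ⟨f, hf, hnorm, hbase⟩ := exists_normalised hmfd h8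
  obtain ⟨X, hX, g, hg, hgX⟩ := listed_of_base hnorm hbase
  refine ⟨X, hX, g ∘ f, ?_, ?_⟩
  · rw [← hgen, verts_genCx]
    rw [sup_image_image, Finset.coe_image] at hg
    exact hg.comp hf (Set.mapsTo_image _ _)
  · rw [← hgX, genCx_image_image, genCx_image_image, hgen, Finset.image_image]
    refine Finset.image_congr fun a _ => ?_
    exact Finset.image_image

end Classification

end NPM

/-- there are exactly 39 combinatorial 3-manifolds on 8 vertices
up to isomorphism, and each one is bistellar equivalent to the standard
3-sphere `S^3_5`. -/
theorem statement2 :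
    ∃ L : List (NPM.Complex ℕ),
      L.length = 39 ∧
      (∀ X ∈ L, NPM.Comb3Mfd X ∧ (NPM.verts X).card = 8) ∧
      L.Pairwise (fun X Y => ¬ NPM.Iso X Y) ∧
      (∀ (α : Type u) [DecidableEq α] (K : NPM.Complex α),
        NPM.Comb3Mfd K → (NPM.verts K).card = 8 → ∃ X ∈ L, NPM.Iso K X) ∧
      (∀ (α : Type u) [DecidableEq α] (K : NPM.Complex α),
        NPM.Comb3Mfd K → (NPM.verts K).card = 8 →
          ∃ K' : NPM.Complex ℕ, NPM.Iso K K' ∧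
            NPM.BEquiv 3 K' (NPM.stdSphere ({0, 1, 2, 3, 4} : Finset ℕ))) := by
  refine ⟨NPM.spheres.map fun X => NPM.genCx (NPM.cx X), by simp [NPM.spheres], ?_, ?_, ?_, ?_⟩
  · intro Y hY
    obtain ⟨X, hX, rfl⟩ := List.mem_map.1 hY
    have hv := NPM.valid_of_mem_spheres X hX
    have hm := NPM.mfdFacets_of_valid hv
    refine ⟨(NPM.comb3Mfd_genCx_iff hm.card).2 hm, ?_⟩
    rw [NPM.verts_genCx, NPM.verts_of_valid hv, Finset.card_range]
  · rw [List.pairwise_map]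
    exact NPM.pairwise_listWeight.imp_of_mem fun hX hY => NPM.not_iso_of_listWeight_ne
      (NPM.valid_of_mem_spheres _ hX) (NPM.valid_of_mem_spheres _ hY)
  · intro α _ K hK h8
    obtain ⟨X, hX, h⟩ := NPM.exists_iso_sphere hK h8
    exact ⟨_, List.mem_map_of_mem hX, h⟩
  · intro α _ K hK h8
    obtain ⟨X, hX, h⟩ := NPM.exists_iso_sphere hK h8
    obtain ⟨p, -, hp⟩ := NPM.exists_reduces X hX
    exact ⟨_, h, NPM.bEquiv_of_reduces hp⟩
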